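/- Let L ⊂ ℙ² be a line over ℂ and p ∈ L a point. Let X₁ and X₂ be smooth plane quartic curves each admitting L as an inflection line with p the corresponding inflection point (i.e. p is the non-reduced point of Xᵢ ∩ L). If X₁ is sufficiently general (i.e. lies in a suitable non-empty Zariski-open subset of such quartics) and X₁ and X₂ have the same configuration of 24 inflection lines counted with multiplicity, then X₁ = X₂. -/

import Mathlib

/-!
STATEMENT 0 (Pacini–Testa, Theorem 1): over ℂ, fix a line `L ⊂ ℙ²` (spanned by two
independent points `p, b`, with `p ∈ L` the marked point).  If `X₁, X₂` are smooth plane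
quartics admitting `L` as an inflection line with inflection point `p` (i.e. `L` meets
`Xᵢ` at `p` with multiplicity `≥ 3`), `X₁` is general among such quartics (it lies in a
suitable nonempty Zariski-open subset, cut out by the nonvanishing of a polynomial `Φ`
in the coefficients which is nonzero somewhere on the locus), and `X₁, X₂` have the same
configuration of 24 inflection lines counted with multiplicity, then `X₁ = X₂`
(i.e. the defining quartics agree up to a nonzero scalar).

Plane curves are given by nonzero homogeneous forms `F ∈ ℂ[x₀,x₁,x₂]`; the intersection
multiplicity of `{F = 0}` with the line through `a, b` at `a` is the order of vanishing
at `t = 0` of `F(a + t b)`; the multiplicity of a line in the configuration of the 24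
inflection lines of a smooth quartic is the sum over the points of the line of
(contact order − 2).
-/

open MvPolynomial Polynomial

noncomputable section

namespace Infl

def dotv (w p : Fin 3 → ℂ) : ℂ := ∑ i, w i * p i

def lineRestrict (F : MvPolynomial (Fin 3) ℂ) (a b : Fin 3 → ℂ) : Polynomial ℂ :=
  MvPolynomial.aeval (fun i => Polynomial.C (a i) + Polynomial.C (b i) * Polynomial.X) F

def contactAt (F : MvPolynomial (Fin 3) ℂ) (a b : Fin 3 → ℂ) : ℕ :=
  (lineRestrict F a b).rootMultiplicity 0

def IsSmoothCurve (F : MvPolynomial (Fin 3) ℂ) (d : ℕ) : Prop :=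
  F.IsHomogeneous d ∧ F ≠ 0 ∧
    ∀ p : Fin 3 → ℂ, p ≠ 0 → eval p F = 0 → ∃ i, eval p (pderiv i F) ≠ 0

def padm (n : ℕ) : ℕ := n - 2

/-- The multiplicity of the line through `a` and `b` in the configuration of the 24
inflection lines (with multiplicity) of a smooth plane quartic `F`. -/
def inflMultLine (F : MvPolynomial (Fin 3) ℂ) (a b : Fin 3 → ℂ) : ℕ :=
  ((lineRestrict F a b).roots.toFinset.sum fun t =>
    padm ((lineRestrict F a b).rootMultiplicity t)) + padm (contactAt F b a)

/-- Evaluation at `F` of a polynomial `Φ` in the coefficients of plane quartics. -/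
def coeffEval (Φ : MvPolynomial (Fin 3 →₀ ℕ) ℂ) (F : MvPolynomial (Fin 3) ℂ) : ℂ :=
  MvPolynomial.eval (fun d => F.coeff d) Φ

/-- `F` is a smooth plane quartic admitting the line through `p` and `b` as an
inflection line, with inflection point `p`. -/
def InflAtMarkedPoint (F : MvPolynomial (Fin 3) ℂ) (p b : Fin 3 → ℂ) : Prop :=
  IsSmoothCurve F 4 ∧ 3 ≤ contactAt F p b

theorem eval_smul_homog {σ : Type*} {F : MvPolynomial σ ℂ} {n : ℕ} (hF : F.IsHomogeneous n)
    (l : ℂ) (x : σ → ℂ) : MvPolynomial.eval (fun i => l * x i) F = l ^ n * MvPolynomial.eval x F := by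
  rw [MvPolynomial.eval_eq, MvPolynomial.eval_eq, Finset.mul_sum]
  refine Finset.sum_congr rfl fun d hd => ?_
  have h1 : d.degree = n := by
    by_contra h
    exact (MvPolynomial.mem_support_iff.mp hd) (hF.coeff_eq_zero h)
  have h2 : ∏ i ∈ d.support, (l * x i) ^ d i = l ^ n * ∏ i ∈ d.support, x i ^ d i := by
    simp_rw [mul_pow]
    rw [Finset.prod_mul_distrib, Finset.prod_pow_eq_pow_sum, ← h1]
    rfl
  rw [h2]; ring

theorem hcomp_eval_zero {σ : Type*} (p : MvPolynomial σ ℂ) (x : σ → ℂ)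
    (h : ∀ l : ℂ, MvPolynomial.eval (fun i => l * x i) p = 0) (k : ℕ) :
    MvPolynomial.eval x (homogeneousComponent k p) = 0 := by
  by_cases hk : p.totalDegree < k
  · rw [homogeneousComponent_eq_zero _ _ hk]; simp
  let P : Polynomial ℂ := ∑ i ∈ Finset.range (p.totalDegree + 1),
    Polynomial.C (MvPolynomial.eval x (homogeneousComponent i p)) * Polynomial.X ^ i
  have hP : P = 0 := by
    apply Polynomial.funext
    intro l
    have h1 := h l
    rw [← sum_homogeneousComponent p, map_sum] at h1
    simp only [P, Polynomial.eval_finsetSum, Polynomial.eval_mul, Polynomial.eval_C,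
      Polynomial.eval_pow, Polynomial.eval_X, Polynomial.eval_zero]
    rw [← h1]
    refine Finset.sum_congr rfl fun i _ => ?_
    rw [eval_smul_homog (homogeneousComponent_isHomogeneous i p), mul_comm]
  have := congrArg (fun q => Polynomial.coeff q k) hP
  simp only [P, Polynomial.finsetSum_coeff, Polynomial.coeff_C_mul, Polynomial.coeff_X_pow,
    Polynomial.coeff_zero] at this
  simpa [Finset.sum_ite_eq, Nat.lt_succ_iff, not_lt.mp hk] using this

/-- Nullstellensatz for a finite family without nontrivial common zeros. -/
theorem null_pow {n : ℕ} {J : Type} [Fintype J] (g : J → MvPolynomial (Fin n) ℂ)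
    (h0 : ∀ x : Fin n → ℂ, (∀ j, MvPolynomial.eval x (g j) = 0) → x = 0) :
    ∃ N : ℕ, 0 < N ∧ ∀ i, ∃ h : J → MvPolynomial (Fin n) ℂ, ∑ j, h j * g j = X i ^ N := by
  have h1 : ∀ i : Fin n, ∃ N : ℕ, (X i : MvPolynomial (Fin n) ℂ) ^ N ∈ Ideal.span (Set.range g) := by
    intro i
    have : (X i : MvPolynomial (Fin n) ℂ) ∈ (Ideal.span (Set.range g)).radical := by
      rw [← vanishingIdeal_zeroLocus_eq_radical (K := ℂ), mem_vanishingIdeal_iff]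
      intro x hx
      rw [zeroLocus_span] at hx
      have := h0 x fun j => by simpa using hx (g j) ⟨j, rfl⟩
      simp [this]
    exact this
  choose N hN using h1
  refine ⟨∑ i, N i + 1, Nat.succ_pos _, fun i => ?_⟩
  have h2 : (X i : MvPolynomial (Fin n) ℂ) ^ (∑ i, N i + 1) ∈ Ideal.span (Set.range g) := by
    refine Ideal.pow_mem_of_pow_mem _ (hN i) ?_
    exact (Finset.single_le_sum (fun _ _ => Nat.zero_le _) (Finset.mem_univ i)).trans (Nat.le_succ _)
  exact (Ideal.mem_span_range_iff_exists_fun).mp h2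

theorem elim {n : ℕ} {J ι : Type} [Fintype J]
    (g : J → MvPolynomial (Fin n) (MvPolynomial ι ℂ))
    (hg : ∀ (j : J) (θ : ι → ℂ) (x : Fin n → ℂ) (l : ℂ),
      MvPolynomial.eval x (MvPolynomial.map (MvPolynomial.eval θ) (g j)) = 0 →
      MvPolynomial.eval (fun i => l * x i) (MvPolynomial.map (MvPolynomial.eval θ) (g j)) = 0)
    (θ₀ : ι → ℂ)
    (h0 : ∀ x : Fin n → ℂ,
      (∀ j, MvPolynomial.eval x (MvPolynomial.map (MvPolynomial.eval θ₀) (g j)) = 0) → x = 0) :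
    ∃ Ψ : MvPolynomial ι ℂ, MvPolynomial.eval θ₀ Ψ ≠ 0 ∧ ∀ θ : ι → ℂ, MvPolynomial.eval θ Ψ ≠ 0 →
      ∀ x : Fin n → ℂ,
        (∀ j, MvPolynomial.eval x (MvPolynomial.map (MvPolynomial.eval θ) (g j)) = 0) → x = 0 := by
  classical
  obtain ⟨N, hNpos, hN⟩ := null_pow _ h0
  choose h hh using hN
  let q : Fin n → MvPolynomial (Fin n) (MvPolynomial ι ℂ) := fun i =>
    ∑ j, MvPolynomial.map MvPolynomial.C (h i j) * g j
  have hmapC : ∀ (θ : ι → ℂ) (p : MvPolynomial (Fin n) ℂ),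
      MvPolynomial.map (MvPolynomial.eval θ) (MvPolynomial.map MvPolynomial.C p) = p := by
    intro θ p
    rw [MvPolynomial.map_map]
    have : (MvPolynomial.eval θ).comp (MvPolynomial.C : ℂ →+* MvPolynomial ι ℂ) = RingHom.id ℂ := by
      ext x; simp
    rw [this, MvPolynomial.map_id]
  have hq0 : ∀ i, MvPolynomial.map (MvPolynomial.eval θ₀) (q i) = X i ^ N := by
    intro i
    simp only [q, map_sum, map_mul, hmapC, hh]
  rcases Nat.eq_zero_or_pos n with hn | hn
  · subst hn
    exact ⟨1, by simp, fun θ _ x _ => Subsingleton.elim _ _⟩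
  let M := n * N
  have hM : 0 < M := Nat.mul_pos hn hNpos
  let s : Finset (Fin n →₀ ℕ) := Finset.finsuppAntidiag Finset.univ M
  have hs : ∀ e, e ∈ s ↔ e.degree = M := by
    intro e
    simp [s, Finset.mem_finsuppAntidiag, Finsupp.degree_eq_sum]
  have hpig : ∀ e : s, ∃ i, N ≤ e.1 i := by
    intro e
    by_contra! hcon
    have h1 := (hs _).mp e.2
    rw [Finsupp.degree_eq_sum] at h1
    have h2 : ∑ i, e.1 i < ∑ _i : Fin n, N :=
      Finset.sum_lt_sum_of_nonempty ⟨⟨0, hn⟩, Finset.mem_univ _⟩ fun i _ => hcon i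
    simp [M] at h1 h2
    omega
  choose idx hidx using hpig
  let r : s → MvPolynomial (Fin n) (MvPolynomial ι ℂ) := fun e =>
    monomial (e.1 - Finsupp.single (idx e) N) 1 * q (idx e)
  have hr0 : ∀ e, MvPolynomial.map (MvPolynomial.eval θ₀) (r e) = monomial e.1 1 := by
    intro e
    simp only [r, map_mul, hq0, MvPolynomial.map_monomial, map_one]
    rw [MvPolynomial.X_pow_eq_monomial, MvPolynomial.monomial_mul, one_mul]
    congr 2
    apply tsub_add_cancel_of_le
    rw [Finsupp.single_le_iff]
    exact hidx e
  let A : Matrix s s (MvPolynomial ι ℂ) := fun e e' => MvPolynomial.coeff e'.1 (r e)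
  refine ⟨A.det, ?_, ?_⟩
  · rw [RingHom.map_det]
    have : (MvPolynomial.eval θ₀).mapMatrix A = 1 := by
      ext e e'
      have : MvPolynomial.eval θ₀ (A e e')
          = MvPolynomial.coeff e'.1 (MvPolynomial.map (MvPolynomial.eval θ₀) (r e)) := by
        rw [MvPolynomial.coeff_map]
      simp only [RingHom.mapMatrix_apply, Matrix.map_apply]
      rw [this, hr0, MvPolynomial.coeff_monomial, Matrix.one_apply]
      simp only [Subtype.ext_iff]
    rw [this]; simp
  · intro θ hθ x hx
    rw [RingHom.map_det] at hθ
    have hrx : ∀ e, ∀ l : ℂ, MvPolynomial.eval (fun i => l * x i)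
        (MvPolynomial.map (MvPolynomial.eval θ) (r e)) = 0 := by
      intro e l
      simp only [r, q, map_mul, map_sum]
      have : ∀ j, MvPolynomial.eval (fun i => l * x i)
          (MvPolynomial.map (MvPolynomial.eval θ) (g j)) = 0 := by
        intro j
        exact hg j θ x l (hx j)
      simp [this]
    have hv : ((MvPolynomial.eval θ).mapMatrix A).mulVec
        (fun e : s => ∏ i ∈ e.1.support, x i ^ e.1 i) = 0 := by
      funext e
      have h1 := hcomp_eval_zero _ _ (hrx e) M
      simp only [Matrix.mulVec, dotProduct, RingHom.mapMatrix_apply, Matrix.map_apply, Pi.zero_apply]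
      rw [← h1, MvPolynomial.eval_eq]
      refine (Finset.sum_coe_sort s (fun e' => MvPolynomial.eval θ (MvPolynomial.coeff e' (r e)) *
        ∏ i ∈ e'.support, x i ^ e' i)).trans ?_
      symm
      refine Finset.sum_subset_zero_on_sdiff ?_ ?_ ?_
      · intro e' he'
        rw [hs]
        by_contra hne
        rw [MvPolynomial.mem_support_iff, MvPolynomial.coeff_homogeneousComponent, if_neg hne] at he'
        exact he' rfl
      · intro e' he'
        rw [Finset.mem_sdiff, MvPolynomial.notMem_support_iff, MvPolynomial.coeff_homogeneousComponent,
          if_pos ((hs _).mp he'.1), MvPolynomial.coeff_map] at he'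
        rw [he'.2, zero_mul]
      · intro e' he'
        have h3 : e'.degree = M := by
          by_contra hne
          rw [MvPolynomial.mem_support_iff, MvPolynomial.coeff_homogeneousComponent,
            if_neg hne] at he'
          exact he' rfl
        rw [MvPolynomial.coeff_homogeneousComponent, if_pos h3, MvPolynomial.coeff_map]
    have hz := Matrix.eq_zero_of_mulVec_eq_zero hθ hv
    funext i
    have h4 : Finsupp.single i M ∈ s := by rw [hs]; simp
    have h5 := congrFun hz ⟨_, h4⟩
    rw [Finsupp.support_single _ hM.ne'] at h5
    simpa [hM.ne'] using h5

/-- A single term of a ternary form. -/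
def tm {R : Type*} [CommRing R] (c : R) (i j k : ℕ) : MvPolynomial (Fin 3) R :=
  MvPolynomial.C c * MvPolynomial.X 0 ^ i * MvPolynomial.X 1 ^ j * MvPolynomial.X 2 ^ k

/-- The quartics with `(1,0,0)` an inflection point with tangent `z = 0`. -/
def gQ {R : Type*} [CommRing R] (θ : Fin 12 → R) : MvPolynomial (Fin 3) R :=
  tm (θ 0) 1 3 0 + tm (θ 1) 0 4 0 + tm (θ 2) 3 0 1 + tm (θ 3) 2 1 1 + tm (θ 4) 1 2 1 + tm (θ 5) 0 3 1 + tm (θ 6) 2 0 2 + tm (θ 7) 1 1 2 + tm (θ 8) 0 2 2 + tm (θ 9) 1 0 3 + tm (θ 10) 0 1 3 + tm (θ 11) 0 0 4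

/-- The invariant of degree two of the restriction to the line `w z = u x + v y`. -/
def gS {R : Type*} [CommRing R] (θ : Fin 12 → R) : MvPolynomial (Fin 3) R :=
  tm (-3 * θ 0 * θ 2) 0 1 3 +
    tm (-3 * θ 0 * θ 3 + 12 * θ 1 * θ 2) 1 0 3 +
    tm (-3 * θ 2 * θ 4 + θ 3 ^ 2) 0 2 2 +
    tm (-6 * θ 0 * θ 6 + 9 * θ 2 * θ 5 - θ 3 * θ 4) 1 1 2 +
    tm (-3 * θ 0 * θ 7 + 12 * θ 1 * θ 6 - 3 * θ 3 * θ 5 + θ 4 ^ 2) 2 0 2 +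
    tm (-3 * θ 2 * θ 7 + 2 * θ 3 * θ 6) 0 3 1 +
    tm (6 * θ 2 * θ 8 + θ 3 * θ 7 - 4 * θ 4 * θ 6) 1 2 1 +
    tm (-9 * θ 0 * θ 9 - 4 * θ 3 * θ 8 + θ 4 * θ 7 + 6 * θ 5 * θ 6) 2 1 1 +
    tm (-3 * θ 0 * θ 10 + 12 * θ 1 * θ 9 + 2 * θ 4 * θ 8 - 3 * θ 5 * θ 7) 3 0 1 +
    tm (-3 * θ 2 * θ 9 + θ 6 ^ 2) 0 4 0 +
    tm (3 * θ 2 * θ 10 + 3 * θ 3 * θ 9 - 2 * θ 6 * θ 7) 1 3 0 +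
    tm (-3 * θ 3 * θ 10 - 3 * θ 4 * θ 9 + 2 * θ 6 * θ 8 + θ 7 ^ 2) 2 2 0 +
    tm (-12 * θ 0 * θ 11 + 3 * θ 4 * θ 10 + 3 * θ 5 * θ 9 - 2 * θ 7 * θ 8) 3 1 0 +
    tm (12 * θ 1 * θ 11 - 3 * θ 5 * θ 10 + θ 8 ^ 2) 4 0 0

/-- The invariant of degree three of the restriction (for normalized quartics). -/
def gT {R : Type*} [CommRing R] (θ : Fin 12 → R) : MvPolynomial (Fin 3) R :=
  tm (-27 * θ 0 ^ 2 * θ 2) 1 0 5 +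
    tm (-27 * θ 1 * θ 2 ^ 2) 0 2 4 +
    tm (-45 * θ 0 * θ 2 * θ 4) 1 1 4 +
    tm (-54 * θ 0 * θ 2 * θ 5 + 72 * θ 1 * θ 2 * θ 4) 2 0 4 +
    tm (-27 * θ 2 ^ 2 * θ 5) 0 3 3 +
    tm (-36 * θ 0 * θ 2 * θ 7 - 18 * θ 2 * θ 4 ^ 2) 1 2 3 +
    tm (-99 * θ 0 * θ 2 * θ 8 + 90 * θ 1 * θ 2 * θ 7 + 27 * θ 2 * θ 4 * θ 5) 2 1 3 +
    tm (9 * θ 0 * θ 4 * θ 7 - 27 * θ 0 ^ 2 * θ 9 + 72 * θ 1 * θ 2 * θ 8 - 27 * θ 2 * θ 5 ^ 2 - 2 * θ 4 ^ 3) 3 0 3 +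
    tm (-27 * θ 2 ^ 2 * θ 8) 0 4 2 +
    tm (-27 * θ 0 * θ 2 * θ 9 - 27 * θ 2 * θ 4 * θ 7) 1 3 2 +
    tm (-135 * θ 0 * θ 2 * θ 10 + 54 * θ 1 * θ 2 * θ 9 - 9 * θ 2 * θ 4 * θ 8 + 54 * θ 2 * θ 5 * θ 7) 2 2 2 +
    tm (-27 * θ 0 * θ 4 * θ 9 + 18 * θ 0 * θ 7 ^ 2 + 162 * θ 1 * θ 2 * θ 10 - 27 * θ 2 * θ 5 * θ 8 - 3 * θ 4 ^ 2 * θ 7) 3 1 2 +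
    tm (9 * θ 0 * θ 4 * θ 10 - 54 * θ 0 * θ 5 * θ 9 + 9 * θ 0 * θ 7 * θ 8 - 27 * θ 0 ^ 2 * θ 11 + 72 * θ 1 * θ 4 * θ 9 - 27 * θ 1 * θ 7 ^ 2 + 9 * θ 4 * θ 5 * θ 7 - 6 * θ 4 ^ 2 * θ 8) 4 0 2 +
    tm (-27 * θ 2 ^ 2 * θ 10) 0 5 1 +
    tm (-18 * θ 2 * θ 4 * θ 9 - 9 * θ 2 * θ 7 ^ 2) 1 4 1 +
    tm (-162 * θ 0 * θ 2 * θ 11 - 36 * θ 2 * θ 4 * θ 10 + 27 * θ 2 * θ 5 * θ 9 + 27 * θ 2 * θ 7 * θ 8) 2 3 1 +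
    tm (27 * θ 0 * θ 7 * θ 9 + 216 * θ 1 * θ 2 * θ 11 + 27 * θ 2 * θ 5 * θ 10 - 18 * θ 2 * θ 8 ^ 2 + 3 * θ 4 * θ 7 ^ 2 - 18 * θ 4 ^ 2 * θ 9) 3 2 1 +
    tm (-18 * θ 0 * θ 4 * θ 11 + 45 * θ 0 * θ 7 * θ 10 - 81 * θ 0 * θ 8 * θ 9 - 18 * θ 1 * θ 7 * θ 9 + 45 * θ 4 * θ 5 * θ 9 + 3 * θ 4 * θ 7 * θ 8 - 9 * θ 4 ^ 2 * θ 10 - 9 * θ 5 * θ 7 ^ 2) 4 1 1 +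
    tm (-54 * θ 0 * θ 5 * θ 11 + 9 * θ 0 * θ 8 * θ 10 + 72 * θ 1 * θ 4 * θ 11 - 54 * θ 1 * θ 7 * θ 10 + 72 * θ 1 * θ 8 * θ 9 + 9 * θ 4 * θ 5 * θ 10 - 6 * θ 4 * θ 8 ^ 2 + 9 * θ 5 * θ 7 * θ 8 - 27 * θ 5 ^ 2 * θ 9) 5 0 1 +
    tm (-27 * θ 2 ^ 2 * θ 11) 0 6 0 +
    tm (-9 * θ 2 * θ 7 * θ 9) 1 5 0 +
    tm (-54 * θ 2 * θ 4 * θ 11 + 9 * θ 2 * θ 7 * θ 10 + 9 * θ 2 * θ 8 * θ 9) 2 4 0 +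
    tm (27 * θ 0 * θ 9 ^ 2 + 54 * θ 2 * θ 5 * θ 11 - 9 * θ 2 * θ 8 * θ 10 - 9 * θ 4 * θ 7 * θ 9 + 2 * θ 7 ^ 3) 3 3 0 +
    tm (72 * θ 0 * θ 7 * θ 11 - 54 * θ 0 * θ 9 * θ 10 - 27 * θ 1 * θ 9 ^ 2 + 9 * θ 4 * θ 7 * θ 10 + 9 * θ 4 * θ 8 * θ 9 - 27 * θ 4 ^ 2 * θ 11 + 9 * θ 5 * θ 7 * θ 9 - 6 * θ 7 ^ 2 * θ 8) 4 2 0 +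
    tm (-72 * θ 0 * θ 8 * θ 11 + 27 * θ 0 * θ 10 ^ 2 - 72 * θ 1 * θ 7 * θ 11 + 54 * θ 1 * θ 9 * θ 10 + 54 * θ 4 * θ 5 * θ 11 - 9 * θ 4 * θ 8 * θ 10 - 9 * θ 5 * θ 7 * θ 10 - 9 * θ 5 * θ 8 * θ 9 + 6 * θ 7 * θ 8 ^ 2) 5 1 0 +
    tm (72 * θ 1 * θ 8 * θ 11 - 27 * θ 1 * θ 10 ^ 2 + 9 * θ 5 * θ 8 * θ 10 - 27 * θ 5 ^ 2 * θ 11 - 2 * θ 8 ^ 3) 6 0 0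

theorem tm_hom {R : Type*} [CommRing R] (c : R) (i j k n : ℕ) (h : i + j + k = n) :
    (tm c i j k).IsHomogeneous n := by
  subst h
  unfold tm
  have h1 := (((MvPolynomial.isHomogeneous_C (Fin 3) c).mul
    (MvPolynomial.isHomogeneous_X_pow (R := R) (0 : Fin 3) i)).mul
    (MvPolynomial.isHomogeneous_X_pow (R := R) (1 : Fin 3) j)).mul
    (MvPolynomial.isHomogeneous_X_pow (R := R) (2 : Fin 3) k)
  simpa using h1

theorem gQ_hom {R : Type*} [CommRing R] (θ : Fin 12 → R) : (gQ θ).IsHomogeneous 4 := by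
  unfold gQ
  repeat' (with_reducible apply MvPolynomial.IsHomogeneous.add)
  all_goals exact tm_hom _ _ _ _ _ (by norm_num)

theorem gS_hom {R : Type*} [CommRing R] (θ : Fin 12 → R) : (gS θ).IsHomogeneous 4 := by
  unfold gS
  repeat' (with_reducible apply MvPolynomial.IsHomogeneous.add)
  all_goals exact tm_hom _ _ _ _ _ (by norm_num)

theorem gT_hom {R : Type*} [CommRing R] (θ : Fin 12 → R) : (gT θ).IsHomogeneous 6 := by
  unfold gT
  repeat' (with_reducible apply MvPolynomial.IsHomogeneous.add)
  all_goals exact tm_hom _ _ _ _ _ (by norm_num)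

theorem map_tm {R R' : Type*} [CommRing R] [CommRing R'] (φ : R →+* R') (c : R) (i j k : ℕ) :
    MvPolynomial.map φ (tm c i j k) = tm (φ c) i j k := by
  simp [tm]

theorem map_gQ {R R' : Type*} [CommRing R] [CommRing R'] (φ : R →+* R') (θ : Fin 12 → R) :
    MvPolynomial.map φ (gQ θ) = gQ (fun i => φ (θ i)) := by
  simp only [gQ, map_tm, map_add]

theorem map_gS {R R' : Type*} [CommRing R] [CommRing R'] (φ : R →+* R') (θ : Fin 12 → R) :
    MvPolynomial.map φ (gS θ) = gS (fun i => φ (θ i)) := by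
  simp only [gS, map_tm, map_add, map_sub, map_neg, map_mul, map_pow, map_ofNat]

theorem map_gT {R R' : Type*} [CommRing R] [CommRing R'] (φ : R →+* R') (θ : Fin 12 → R) :
    MvPolynomial.map φ (gT θ) = gT (fun i => φ (θ i)) := by
  simp only [gT, map_tm, map_add, map_sub, map_neg, map_mul, map_pow, map_ofNat]

theorem eval_tm {R : Type*} [CommRing R] (x : Fin 3 → R) (c : R) (i j k : ℕ) :
    MvPolynomial.eval x (tm c i j k) = c * x 0 ^ i * x 1 ^ j * x 2 ^ k := by
  simp [tm]

/-- Coefficients of the restriction to the line spanned by `(1,0,s)` and `(0,1,t)`. -/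
def kk (θ : Fin 12 → ℂ) (s t : ℂ) : Fin 5 → ℂ :=
  ![θ 2 * s + θ 6 * s ^ 2 + θ 9 * s ^ 3 + θ 11 * s ^ 4,
    θ 2 * t + θ 3 * s + 2 * θ 6 * s * t + θ 7 * s ^ 2 + 3 * θ 9 * s ^ 2 * t + θ 10 * s ^ 3 + 4 * θ 11 * s ^ 3 * t,
    θ 3 * t + θ 4 * s + θ 6 * t ^ 2 + 2 * θ 7 * s * t + θ 8 * s ^ 2 + 3 * θ 9 * s * t ^ 2 + 3 * θ 10 * s ^ 2 * t + 6 * θ 11 * s ^ 2 * t ^ 2,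
    θ 0 + θ 4 * t + θ 5 * s + θ 7 * t ^ 2 + 2 * θ 8 * s * t + θ 9 * t ^ 3 + 3 * θ 10 * s * t ^ 2 + 4 * θ 11 * s * t ^ 3,
    θ 1 + θ 5 * t + θ 8 * t ^ 2 + θ 10 * t ^ 3 + θ 11 * t ^ 4]

/-- A quartic with given coefficients. -/
def quart (k : Fin 5 → ℂ) : Polynomial ℂ :=
  Polynomial.C (k 0) + Polynomial.C (k 1) * Polynomial.X + Polynomial.C (k 2) * Polynomial.X ^ 2 +
    Polynomial.C (k 3) * Polynomial.X ^ 3 + Polynomial.C (k 4) * Polynomial.X ^ 4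

def invI (k : Fin 5 → ℂ) : ℂ := 12 * k 0 * k 4 - 3 * k 1 * k 3 + k 2 ^ 2

def invJ (k : Fin 5 → ℂ) : ℂ := 72 * k 0 * k 2 * k 4 + 9 * k 1 * k 2 * k 3 - 27 * k 0 * k 3 ^ 2
  - 27 * k 4 * k 1 ^ 2 - 2 * k 2 ^ 3

theorem restrict_gQ (θ : Fin 12 → ℂ) (s t : ℂ) :
    lineRestrict (gQ θ) ![1, 0, s] ![0, 1, t] = quart (kk θ s t) := by
  simp only [lineRestrict, gQ, tm, quart, kk, map_add, map_mul, map_pow, MvPolynomial.aeval_X,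
    MvPolynomial.algHom_C, Polynomial.algebraMap_eq, Matrix.cons_val]
  simp only [map_one, map_zero, map_ofNat]
  ring

theorem restrict_gQ_swap (θ : Fin 12 → ℂ) (s t : ℂ) :
    lineRestrict (gQ θ) ![0, 1, t] ![1, 0, s] = quart (fun i => kk θ s t (4 - i)) := by
  simp only [lineRestrict, gQ, tm, quart, kk, map_add, map_mul, map_pow, MvPolynomial.aeval_X,
    MvPolynomial.algHom_C, Polynomial.algebraMap_eq, Matrix.cons_val, sub_zero,
    show (4 : Fin 5) - 1 = 3 from rfl, show (4 : Fin 5) - 2 = 2 from rfl,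
    show (4 : Fin 5) - 3 = 1 from rfl, show (4 : Fin 5) - 4 = 0 from rfl]
  simp only [map_one, map_zero, map_ofNat]
  ring

theorem invI_kk (θ : Fin 12 → ℂ) (s t : ℂ) :
    invI (kk θ s t) = MvPolynomial.eval ![s, t, 1] (gS θ) := by
  simp only [invI, kk, gS, map_add, eval_tm, Matrix.cons_val]
  ring

theorem invJ_kk (θ : Fin 12 → ℂ) (s t : ℂ) (h3 : θ 3 = 0) (h6 : θ 6 = 0) :
    invJ (kk θ s t) = MvPolynomial.eval ![s, t, 1] (gT θ) := by
  simp only [invJ, kk, gT, map_add, eval_tm, Matrix.cons_val, h3, h6]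
  ring

theorem three_le_of_factor {q h : Polynomial ℂ} (r : ℂ) (hq : q ≠ 0)
    (e : q = (Polynomial.X - Polynomial.C r) ^ 3 * h) : 3 ≤ q.rootMultiplicity r :=
  (Polynomial.le_rootMultiplicity_iff hq).mpr ⟨h, e⟩

theorem quart_ne_zero {k : Fin 5 → ℂ} (hk : k ≠ 0) : quart k ≠ 0 := by
  intro h
  apply hk
  have hc : ∀ n, (quart k).coeff n = 0 := by intro n; rw [h]; simp
  funext i
  have h0 := hc 0
  have h1 := hc 1
  have h2 := hc 2
  have h3 := hc 3
  have h4 := hc 4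
  simp [quart, Polynomial.coeff_X, Polynomial.coeff_C] at h0 h1 h2 h3 h4
  fin_cases i <;> simp [h0, h1, h2, h3, h4]

theorem triple_of_inv {k : Fin 5 → ℂ} (hk : k ≠ 0) (hI : invI k = 0) (hJ : invJ k = 0) :
    (∃ r, 3 ≤ (quart k).rootMultiplicity r) ∨
      3 ≤ (quart (fun i => k (4 - i))).rootMultiplicity 0 := by
  have hne := quart_ne_zero hk
  have hne' : quart (fun i => k (4 - i)) ≠ 0 := by
    apply quart_ne_zero
    intro h
    apply hk
    funext i
    have := congrFun h (4 - i)
    simpa using this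
  unfold invI at hI
  unfold invJ at hJ
  by_cases h4 : k 4 = 0
  · rw [h4] at hI hJ
    by_cases h3 : k 3 = 0
    · right
      rw [h3] at hI
      have h2 : k 2 = 0 := by simpa using hI
      refine three_le_of_factor (h := Polynomial.C (k 1) + Polynomial.C (k 0) * Polynomial.X) 0 hne' ?_
      simp only [quart, sub_zero, show (4 : Fin 5) - 1 = 3 from rfl,
        show (4 : Fin 5) - 2 = 2 from rfl, show (4 : Fin 5) - 3 = 1 from rfl,
        show (4 : Fin 5) - 4 = 0 from rfl, h4, h3, h2, map_zero]
      ring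
    · left
      refine ⟨-k 2 / (3 * k 3), three_le_of_factor (h := Polynomial.C (k 3)) _ hne ?_⟩
      obtain ⟨r, hr⟩ : ∃ r, r = -k 2 / (3 * k 3) := ⟨_, rfl⟩
      have e2 : k 2 = -3 * r * k 3 := by rw [hr]; field_simp
      rw [← hr]
      have e1 : k 1 = 3 * r ^ 2 * k 3 := by
        rw [e2] at hI
        apply mul_left_cancel₀ h3
        linear_combination (-1 / 3) * hI
      have e0 : k 0 = -r ^ 3 * k 3 := by
        rw [e2, e1] at hJ
        apply mul_left_cancel₀ (pow_ne_zero 2 h3)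
        linear_combination (-1 / 27) * hJ
      simp only [quart, e0, e1, e2, h4, map_mul, map_neg, map_pow, map_ofNat, map_zero]
      ring
  · left
    have hdeg : (quart k).degree ≠ 0 := by
      have : (quart k).natDegree = 4 := by
        unfold quart; compute_degree!
      rw [Polynomial.degree_eq_natDegree hne, this]; norm_num
    obtain ⟨r, hr⟩ := IsAlgClosed.exists_root _ hdeg
    simp only [Polynomial.IsRoot, quart, Polynomial.eval_add, Polynomial.eval_mul,
      Polynomial.eval_C, Polynomial.eval_pow, Polynomial.eval_X] at hr
    obtain ⟨m1, hm1⟩ : ∃ m1, m1 = k 1 + 2 * k 2 * r + 3 * k 3 * r ^ 2 + 4 * k 4 * r ^ 3 := ⟨_, rfl⟩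
    obtain ⟨m2, hm2⟩ : ∃ m2, m2 = k 2 + 3 * k 3 * r + 6 * k 4 * r ^ 2 := ⟨_, rfl⟩
    obtain ⟨m3, hm3⟩ : ∃ m3, m3 = k 3 + 4 * k 4 * r := ⟨_, rfl⟩
    have e3 : k 3 = m3 - 4 * k 4 * r := by rw [hm3]; ring
    have e2 : k 2 = m2 - 3 * (m3 - 4 * k 4 * r) * r - 6 * k 4 * r ^ 2 := by rw [hm2, e3]; ring
    have e1 : k 1 = m1 - 2 * (m2 - 3 * (m3 - 4 * k 4 * r) * r - 6 * k 4 * r ^ 2) * r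
        - 3 * (m3 - 4 * k 4 * r) * r ^ 2 - 4 * k 4 * r ^ 3 := by rw [hm1, e2, e3]; ring
    have e0 : k 0 = -(m1 * r) + m2 * r ^ 2 - m3 * r ^ 3 + k 4 * r ^ 4 := by
      rw [e1, e2, e3] at hr
      linear_combination hr
    have I' : m2 ^ 2 = 3 * m1 * m3 := by
      rw [e0, e1, e2, e3] at hI
      linear_combination hI
    have J' : 9 * m1 * m2 * m3 - 27 * k 4 * m1 ^ 2 - 2 * m2 ^ 3 = 0 := by
      rw [e0, e1, e2, e3] at hJ
      linear_combination hJ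
    by_cases hz : m1 = 0
    · have hz2 : m2 = 0 := by rw [hz] at I'; simpa using I'
      refine ⟨r, three_le_of_factor (h := Polynomial.C m3 +
        Polynomial.C (k 4) * (Polynomial.X - Polynomial.C r)) r hne ?_⟩
      simp only [quart, e0, e1, e2, e3, hz, hz2, map_mul, map_neg, map_pow, map_ofNat, map_zero,
        map_sub, map_add]
      ring
    · have hc : m2 ^ 3 = 27 * k 4 * m1 ^ 2 := by linear_combination J' + 3 * m2 * I'
      have hz2 : m2 ≠ 0 := by
        intro h0
        rw [h0] at hc
        have : 27 * k 4 * m1 ^ 2 ≠ 0 := by simp [h4, hz]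
        apply this; rw [← hc]; ring
      obtain ⟨w, hw⟩ : ∃ w, w = 3 * m1 / m2 := ⟨_, rfl⟩
      have f1 : m1 = w * m2 / 3 := by rw [hw]; field_simp
      have hw0 : w ≠ 0 := by
        intro h0; apply hz; rw [f1, h0]; ring
      have f2 : m2 = w * m3 := by
        apply mul_left_cancel₀ hz2
        rw [f1] at I'
        linear_combination I'
      have f3 : m3 = 3 * w * k 4 := by
        have : w ^ 2 * m3 ^ 2 * w * (m3 - 3 * w * k 4) = 0 := by
          rw [f1, f2] at hc
          linear_combination hc
        have hm30 : m3 ≠ 0 := by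
          intro h0; apply hz2; rw [f2, h0]; ring
        have h9 : w ^ 2 * m3 ^ 2 * w ≠ 0 := by
          exact mul_ne_zero (mul_ne_zero (pow_ne_zero _ hw0) (pow_ne_zero _ hm30)) hw0
        have := (mul_eq_zero.mp this).resolve_left h9
        linear_combination this
      refine ⟨r - w, three_le_of_factor (h := Polynomial.C (k 4) *
        (Polynomial.X - Polynomial.C r)) (r - w) hne ?_⟩
      have f1' : m1 = w ^ 3 * k 4 := by rw [f1, f2, f3]; ring
      have f2' : m2 = 3 * w ^ 2 * k 4 := by rw [f2, f3]; ring
      simp only [quart, e0, e1, e2, e3, f1', f2', f3, map_mul, map_neg, map_pow, map_ofNat,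
        map_sub, map_add]
      ring

theorem inv_of_triple {k : Fin 5 → ℂ} {r : ℂ} (h : 3 ≤ (quart k).rootMultiplicity r) :
    invI k = 0 := by
  have hd : (Polynomial.X - Polynomial.C r) ^ 3 ∣ quart k :=
    (pow_dvd_pow _ h).trans (Polynomial.pow_rootMultiplicity_dvd _ _)
  obtain ⟨g, hg⟩ := hd
  have h0 : (quart k).eval r = 0 := by rw [hg]; simp
  have h1 : (quart k).derivative.eval r = 0 := by rw [hg]; simp [Polynomial.derivative_mul, Polynomial.derivative_pow]
  have h2 : (quart k).derivative.derivative.eval r = 0 := by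
    rw [hg]; simp [Polynomial.derivative_mul, Polynomial.derivative_pow]
  simp [quart] at h0 h1 h2
  unfold invI
  linear_combination 12 * k 4 * h0 - 3 * (k 3 + 4 * k 4 * r) * h1 +
    (k 2 + 3 * k 3 * r + 6 * k 4 * r ^ 2) / 2 * h2

/-- Bitangent-free part: a flex line in the standard chart gives a zero of the invariant. -/
theorem gS_zero_of_infl {θ : Fin 12 → ℂ} {s t : ℂ}
    (h : 0 < inflMultLine (gQ θ) ![1, 0, s] ![0, 1, t]) :
    MvPolynomial.eval ![s, t, 1] (gS θ) = 0 := by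
  rw [← invI_kk]
  unfold inflMultLine at h
  rcases Nat.add_pos_iff_pos_or_pos.mp h with h | h
  · obtain ⟨r, hr, hr'⟩ := Finset.exists_ne_zero_of_sum_ne_zero (Nat.pos_iff_ne_zero.mp h)
    rw [restrict_gQ] at hr'
    apply inv_of_triple (r := r)
    unfold padm at hr'
    omega
  · unfold contactAt padm at h
    rw [restrict_gQ_swap] at h
    have := inv_of_triple (k := fun i => kk θ s t (4 - i)) (r := 0) (by omega)
    unfold invI at this ⊢
    simp only [sub_zero, show (4 : Fin 5) - 1 = 3 from rfl,
        show (4 : Fin 5) - 2 = 2 from rfl, show (4 : Fin 5) - 3 = 1 from rfl,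
        show (4 : Fin 5) - 4 = 0 from rfl] at this
    linear_combination this

theorem infl_of_zero {θ : Fin 12 → ℂ} {s t : ℂ} (h3 : θ 3 = 0) (h6 : θ 6 = 0)
    (hk : kk θ s t ≠ 0) (hS : MvPolynomial.eval ![s, t, 1] (gS θ) = 0)
    (hT : MvPolynomial.eval ![s, t, 1] (gT θ) = 0) :
    0 < inflMultLine (gQ θ) ![1, 0, s] ![0, 1, t] := by
  rw [← invI_kk] at hS
  rw [← invJ_kk θ s t h3 h6] at hT
  have hne := quart_ne_zero hk
  unfold inflMultLine
  rcases triple_of_inv hk hS hT with ⟨r, hr⟩ | h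
  · apply Nat.add_pos_left
    rw [restrict_gQ]
    have hmem : r ∈ (quart (kk θ s t)).roots.toFinset := by
      rw [Multiset.mem_toFinset, Polynomial.mem_roots hne, ← Polynomial.rootMultiplicity_pos hne]
      omega
    have := Finset.single_le_sum (f := fun x => padm ((quart (kk θ s t)).rootMultiplicity x))
      (fun _ _ => Nat.zero_le _) hmem
    refine lt_of_lt_of_le ?_ this
    simp only [padm]
    omega
  · apply Nat.add_pos_right
    unfold contactAt padm
    rw [restrict_gQ_swap]
    omega

theorem aeval_smul_homog {σ B : Type*} [CommRing B] [Algebra ℂ B] {F : MvPolynomial σ ℂ} {n : ℕ}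
    (hF : F.IsHomogeneous n) (l : B) (x : σ → B) :
    MvPolynomial.aeval (fun i => l * x i) F = l ^ n * MvPolynomial.aeval x F := by
  rw [MvPolynomial.aeval_def, MvPolynomial.aeval_def, MvPolynomial.eval₂_eq, MvPolynomial.eval₂_eq,
    Finset.mul_sum]
  refine Finset.sum_congr rfl fun d hd => ?_
  have h1 : d.degree = n := by
    by_contra h
    exact (MvPolynomial.mem_support_iff.mp hd) (hF.coeff_eq_zero h)
  have h2 : ∏ i ∈ d.support, (l * x i) ^ d i = l ^ n * ∏ i ∈ d.support, x i ^ d i := by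
    simp_rw [mul_pow]
    rw [Finset.prod_mul_distrib, Finset.prod_pow_eq_pow_sum, ← h1]
    rfl
  rw [h2]; ring

/-- A form vanishing at `P` lies in the ideal of `P`. -/
theorem mem_ideal_point {H : MvPolynomial (Fin 3) ℂ} {d : ℕ} (hH : H.IsHomogeneous d)
    (P : Fin 3 → ℂ) (hP : MvPolynomial.eval P H = 0) :
    ∃ A B : MvPolynomial (Fin 3) ℂ,
      A * (MvPolynomial.C (P 2) * MvPolynomial.X 0 - MvPolynomial.C (P 0) * MvPolynomial.X 2) +
      B * (MvPolynomial.C (P 2) * MvPolynomial.X 1 - MvPolynomial.C (P 1) * MvPolynomial.X 2) =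
      MvPolynomial.C (P 2 ^ d) * H := by
  rw [← Ideal.mem_span_pair, ← Ideal.Quotient.eq_zero_iff_mem]
  set I := Ideal.span ({MvPolynomial.C (P 2) * MvPolynomial.X 0 - MvPolynomial.C (P 0) * MvPolynomial.X 2,
    MvPolynomial.C (P 2) * MvPolynomial.X 1 - MvPolynomial.C (P 1) * MvPolynomial.X 2} :
      Set (MvPolynomial (Fin 3) ℂ)) with hI
  let φ := Ideal.Quotient.mkₐ ℂ I
  have hrel : ∀ i : Fin 3, φ (MvPolynomial.C (P 2)) * φ (MvPolynomial.X i) =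
      φ (MvPolynomial.X 2) * φ (MvPolynomial.C (P i)) := by
    intro i
    rw [← map_mul, ← map_mul]
    refine Ideal.Quotient.eq.mpr ?_
    fin_cases i
    · apply Ideal.subset_span
      left
      simp only [Fin.zero_eta]
      ring
    · apply Ideal.subset_span
      right
      simp only [Fin.mk_one]
      rw [Set.mem_singleton_iff]
      ring
    · have : MvPolynomial.C (P 2) * MvPolynomial.X 2 - MvPolynomial.X 2 * MvPolynomial.C (P 2)
        = (0 : MvPolynomial (Fin 3) ℂ) := by ring
      simp [this]
  have h1 : φ H = MvPolynomial.aeval (fun i => φ (MvPolynomial.X i)) H := by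
    conv_lhs => rw [← MvPolynomial.aeval_X_left_apply (R := ℂ) H]
    rw [← MvPolynomial.comp_aeval_apply]
  change φ (MvPolynomial.C (P 2 ^ d) * H) = 0
  rw [map_mul, map_pow, map_pow, h1, ← aeval_smul_homog hH]
  simp_rw [hrel]
  rw [aeval_smul_homog hH]
  have h2 : MvPolynomial.aeval (fun i => φ (MvPolynomial.C (P i))) H
      = φ (MvPolynomial.C (MvPolynomial.eval P H)) := by
    have : ∀ z : ℂ, φ (MvPolynomial.C z) = algebraMap ℂ _ z := fun z => by
      rw [← MvPolynomial.algebraMap_eq]; exact φ.commutes z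
    simp_rw [this]
    exact MvPolynomial.aeval_algebraMap_apply _ P H
  rw [h2, hP]; simp

theorem pderiv_at_point {H A B : MvPolynomial (Fin 3) ℂ} {c : ℂ} {P : Fin 3 → ℂ}
    (h : A * (MvPolynomial.C (P 2) * MvPolynomial.X 0 - MvPolynomial.C (P 0) * MvPolynomial.X 2) +
      B * (MvPolynomial.C (P 2) * MvPolynomial.X 1 - MvPolynomial.C (P 1) * MvPolynomial.X 2) =
      MvPolynomial.C c * H) :
    MvPolynomial.eval P A * P 2 = c * MvPolynomial.eval P (pderiv 0 H) ∧
    MvPolynomial.eval P B * P 2 = c * MvPolynomial.eval P (pderiv 1 H) := by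
  have h0 := congrArg (fun q => MvPolynomial.eval P (pderiv 0 q)) h
  have h1 := congrArg (fun q => MvPolynomial.eval P (pderiv 1 q)) h
  simp [Derivation.leibniz, pderiv_X] at h0 h1
  constructor
  · linear_combination h0
  · linear_combination h1

theorem minors_zero {a b c a' b' c' u v w : ℂ} (hw : w ≠ 0) (h1 : u * a + v * b + w * c = 0)
    (h2 : u * a' + v * b' + w * c' = 0) (h : a * b' - b * a' = 0) :
    b * c' - c * b' = 0 ∧ c * a' - a * c' = 0 := by
  constructor
  · apply mul_left_cancel₀ hw
    linear_combination b * h2 - b' * h1 + u * h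
  · apply mul_left_cancel₀ hw
    linear_combination a' * h1 - a * h2 + v * h

theorem euler_at {H : MvPolynomial (Fin 3) ℂ} {d : ℕ} (hH : H.IsHomogeneous d) {P : Fin 3 → ℂ}
    (h0 : MvPolynomial.eval P H = 0) :
    P 0 * MvPolynomial.eval P (pderiv 0 H) + P 1 * MvPolynomial.eval P (pderiv 1 H) +
      P 2 * MvPolynomial.eval P (pderiv 2 H) = 0 := by
  have := congrArg (MvPolynomial.eval P) hH.sum_X_mul_pderiv
  rw [Fin.sum_univ_three] at this
  simpa [h0] using this

theorem eval_affine {H : MvPolynomial (Fin 3) ℂ} {d : ℕ} (hH : H.IsHomogeneous d) {P : Fin 3 → ℂ}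
    (hP : P 2 ≠ 0) :
    MvPolynomial.eval P H = P 2 ^ d * MvPolynomial.eval ![P 0 / P 2, P 1 / P 2, 1] H := by
  rw [← eval_smul_homog hH]
  congr 2
  funext i
  fin_cases i
  · simp; field_simp
  · simp; field_simp
  · simp

theorem exists_pow_w {S T G : MvPolynomial (Fin 3) ℂ} {dS dT dG : ℕ}
    (hS : S.IsHomogeneous dS) (hT : T.IsHomogeneous dT) (hG : G.IsHomogeneous dG)
    (h2 : ∀ x, MvPolynomial.eval x S = 0 → MvPolynomial.eval x T = 0 →
      MvPolynomial.eval x (pderiv 0 S * pderiv 1 T - pderiv 1 S * pderiv 0 T) = 0 →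
      MvPolynomial.eval x (pderiv 1 S * pderiv 2 T - pderiv 2 S * pderiv 1 T) = 0 →
      MvPolynomial.eval x (pderiv 2 S * pderiv 0 T - pderiv 0 S * pderiv 2 T) = 0 → x = 0)
    (h3 : ∀ s t : ℂ, MvPolynomial.eval ![s, t, 1] S = 0 → MvPolynomial.eval ![s, t, 1] T = 0 →
      MvPolynomial.eval ![s, t, 1] G = 0) :
    ∃ N : ℕ, MvPolynomial.X 2 ^ N * G ∈ Ideal.span {S, T} := by
  let J : Ideal (MvPolynomial (Fin 3) ℂ) :=
    { carrier := {h | h * G ∈ Ideal.span {S, T}}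
      add_mem' := fun {a b} ha hb => by
        simp only [Set.mem_ofPred_eq] at *
        rw [add_mul]; exact Ideal.add_mem _ ha hb
      zero_mem' := by simp
      smul_mem' := fun c x hx => by
        simp only [Set.mem_ofPred_eq, smul_eq_mul] at *
        rw [mul_assoc]; exact Ideal.mul_mem_left _ _ hx }
  have hJ : ∀ h, h ∈ J ↔ h * G ∈ Ideal.span {S, T} := fun h => Iff.rfl
  have hSm : S ∈ Ideal.span {S, T} := Ideal.subset_span (by simp)
  have hTm : T ∈ Ideal.span {S, T} := Ideal.subset_span (by simp)
  have key : (MvPolynomial.X 2 : MvPolynomial (Fin 3) ℂ) ∈ J.radical := by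
    rw [← vanishingIdeal_zeroLocus_eq_radical (K := ℂ), mem_vanishingIdeal_iff]
    intro P hP
    have hP' : ∀ h ∈ J, MvPolynomial.eval P h = 0 := fun h hh => by simpa using hP h hh
    by_contra hw
    have hw : P 2 ≠ 0 := by simpa using hw
    have hS0 : MvPolynomial.eval P S = 0 := hP' S ((hJ S).mpr (Ideal.mul_mem_right _ _ hSm))
    have hT0 : MvPolynomial.eval P T = 0 := hP' T ((hJ T).mpr (Ideal.mul_mem_right _ _ hTm))
    have hG0 : MvPolynomial.eval P G = 0 := by
      rw [eval_affine hG hw, h3, mul_zero]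
      · have := eval_affine hS hw
        rw [hS0] at this
        exact (mul_eq_zero.mp this.symm).resolve_left (pow_ne_zero _ hw)
      · have := eval_affine hT hw
        rw [hT0] at this
        exact (mul_eq_zero.mp this.symm).resolve_left (pow_ne_zero _ hw)
    obtain ⟨A, B, hAB⟩ := mem_ideal_point hS P hS0
    obtain ⟨A', B', hAB'⟩ := mem_ideal_point hT P hT0
    obtain ⟨A'', B'', hAB''⟩ := mem_ideal_point hG P hG0
    have hdet : A * B' - A' * B ∈ J := by
      rw [hJ]
      have e : (A * B' - A' * B) * G = MvPolynomial.C ((P 2 ^ dG)⁻¹) *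
          (A'' * (B' * (MvPolynomial.C (P 2 ^ dS) * S) - B * (MvPolynomial.C (P 2 ^ dT) * T)) +
           B'' * (A * (MvPolynomial.C (P 2 ^ dT) * T) - A' * (MvPolynomial.C (P 2 ^ dS) * S))) := by
        have hc : MvPolynomial.C ((P 2 ^ dG)⁻¹) * MvPolynomial.C (P 2 ^ dG) =
            (1 : MvPolynomial (Fin 3) ℂ) := by
          rw [← map_mul, inv_mul_cancel₀ (pow_ne_zero _ hw), map_one]
        rw [← hAB, ← hAB']
        linear_combination (-(A * B' - A' * B) * G) * hc -
          MvPolynomial.C ((P 2 ^ dG)⁻¹) * (A * B' - A' * B) * hAB''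
      rw [e]
      refine Ideal.mul_mem_left _ _ (Ideal.add_mem _ (Ideal.mul_mem_left _ _ (Ideal.sub_mem _ ?_ ?_))
        (Ideal.mul_mem_left _ _ (Ideal.sub_mem _ ?_ ?_))) <;>
        refine Ideal.mul_mem_left _ _ (Ideal.mul_mem_left _ _ ?_) <;> assumption
    have hd := hP' _ hdet
    obtain ⟨p1, p2⟩ := pderiv_at_point hAB
    obtain ⟨p3, p4⟩ := pderiv_at_point hAB'
    have hm : MvPolynomial.eval P (pderiv 0 S) * MvPolynomial.eval P (pderiv 1 T) -
        MvPolynomial.eval P (pderiv 1 S) * MvPolynomial.eval P (pderiv 0 T) = 0 := by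
      have hc : P 2 ^ dS * P 2 ^ dT ≠ 0 := mul_ne_zero (pow_ne_zero _ hw) (pow_ne_zero _ hw)
      apply mul_left_cancel₀ hc
      simp only [map_sub, map_mul] at hd
      linear_combination (-P 2 ^ dT * MvPolynomial.eval P (pderiv 1 T)) * p1
        + (P 2 ^ dT * MvPolynomial.eval P (pderiv 0 T)) * p2
        + (MvPolynomial.eval P B * P 2) * p3 - (MvPolynomial.eval P A * P 2) * p4
        + (P 2) ^ 2 * hd
    obtain ⟨m1, m2⟩ := minors_zero hw (euler_at hS hS0) (euler_at hT hT0) hm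
    have := h2 P hS0 hT0 (by simpa using hm) (by simpa using m1) (by simpa using m2)
    rw [this] at hw
    exact hw rfl
  obtain ⟨N, hN⟩ := key
  exact ⟨N, hN⟩

theorem X_relprime (N : ℕ) : IsRelPrime (MvPolynomial.X 0 ^ N : MvPolynomial (Fin 3) ℂ)
    (MvPolynomial.X 1 ^ N) := by
  apply IsRelPrime.pow
  have h0 : Prime (MvPolynomial.X 0 : MvPolynomial (Fin 3) ℂ) := MvPolynomial.X_prime
  rw [h0.irreducible.isRelPrime_iff_not_dvd]
  rintro ⟨q, hq⟩
  have := congrArg (MvPolynomial.eval ![0, 1, 0]) hq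
  simp at this

theorem sub_dvd_X2 (a : MvPolynomial (Fin 3) ℂ) : ∃ r, a = MvPolynomial.aeval
    ![(MvPolynomial.X 0 : MvPolynomial (Fin 3) ℂ), MvPolynomial.X 1, 0] a + MvPolynomial.X 2 * r := by
  induction a using MvPolynomial.induction_on with
  | C c => exact ⟨0, by simp⟩
  | add p q hp hq =>
    obtain ⟨r, hr⟩ := hp
    obtain ⟨r', hr'⟩ := hq
    refine ⟨r + r', ?_⟩
    rw [map_add]
    linear_combination hr + hr'
  | mul_X p i hp =>
    obtain ⟨r, hr⟩ := hp
    rw [map_mul, MvPolynomial.aeval_X]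
    fin_cases i
    · refine ⟨r * MvPolynomial.X 0, ?_⟩
      simp only [Fin.zero_eta, Fin.mk_one, Matrix.cons_val]
      linear_combination MvPolynomial.X 0 * hr
    · refine ⟨r * MvPolynomial.X 1, ?_⟩
      simp only [Fin.zero_eta, Fin.mk_one, Matrix.cons_val]
      linear_combination MvPolynomial.X 1 * hr
    · refine ⟨p, ?_⟩
      simp
      ring

theorem descend_w {S T : MvPolynomial (Fin 3) ℂ}
    (h1 : ∀ x, MvPolynomial.eval x S = 0 → MvPolynomial.eval x T = 0 → x 2 = 0 → x = 0)
    {H : MvPolynomial (Fin 3) ℂ} (hH : MvPolynomial.X 2 * H ∈ Ideal.span {S, T}) :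
    H ∈ Ideal.span {S, T} := by
  obtain ⟨N, hN, h⟩ := null_pow ![S, T, MvPolynomial.X 2] (by
    intro x hx
    exact h1 x (by simpa using hx 0) (by simpa using hx 1) (by simpa using hx 2))
  obtain ⟨π, hπ⟩ : ∃ π, π = MvPolynomial.aeval (R := ℂ)
    ![(MvPolynomial.X 0 : MvPolynomial (Fin 3) ℂ), MvPolynomial.X 1, 0] := ⟨_, rfl⟩
  have hπ2 : π (MvPolynomial.X 2) = 0 := by simp [hπ]
  have hdec : ∀ a, ∃ r, a = π a + MvPolynomial.X 2 * r := by rw [hπ]; exact sub_dvd_X2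
  have hrel : IsRelPrime (π S) (π T) := by
    intro d hd1 hd2
    apply X_relprime N
    · obtain ⟨g, hg⟩ := h 0
      have := congrArg π hg
      rw [Fin.sum_univ_three] at this
      simp only [map_add, map_mul, Matrix.cons_val, hπ2, mul_zero, add_zero, map_pow] at this
      have hx : π (MvPolynomial.X 0) = MvPolynomial.X 0 := by simp [hπ]
      rw [hx] at this
      rw [← this]
      exact dvd_add (hd1.mul_left _) (hd2.mul_left _)
    · obtain ⟨g, hg⟩ := h 1
      have := congrArg π hg
      rw [Fin.sum_univ_three] at this
      simp only [map_add, map_mul, Matrix.cons_val, hπ2, mul_zero, add_zero, map_pow] at this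
      have hx : π (MvPolynomial.X 1) = MvPolynomial.X 1 := by simp [hπ]
      rw [hx] at this
      rw [← this]
      exact dvd_add (hd1.mul_left _) (hd2.mul_left _)
  obtain ⟨a, b, hab⟩ := Ideal.mem_span_pair.mp hH
  have hp := congrArg π hab
  rw [map_add, map_mul, map_mul, map_mul, hπ2, zero_mul] at hp
  have hd : π S ∣ π b := by
    apply hrel.dvd_of_dvd_mul_right
    exact ⟨-π a, by linear_combination hp⟩
  obtain ⟨e, he⟩ := hd
  have hX : (MvPolynomial.X 2 : MvPolynomial (Fin 3) ℂ) ≠ 0 := MvPolynomial.X_ne_zero 2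
  obtain ⟨a1, ha1⟩ := hdec a
  obtain ⟨b1, hb1⟩ := hdec b
  obtain ⟨s1, hs1⟩ := hdec S
  obtain ⟨t1, ht1⟩ := hdec T
  have hae : π S = 0 ∨ π a = -(e * π T) := by
    by_cases h0 : π S = 0
    · exact Or.inl h0
    · right
      apply mul_left_cancel₀ h0
      rw [he] at hp
      linear_combination hp
  rcases hae with h0 | hae
  · have hu : IsUnit (π T) := by
      apply hrel
      · rw [h0]; exact dvd_zero _
      · exact dvd_rfl
    obtain ⟨t, ht⟩ := hu.exists_right_inv
    have hb0 : π b = 0 := by rw [he, h0, zero_mul]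
    rw [Ideal.mem_span_pair]
    obtain ⟨f, hf⟩ : ∃ f, f = -(t * π a) := ⟨_, rfl⟩
    have hfa : π a = -(f * π T) := by rw [hf]; linear_combination -π a * ht
    refine ⟨a1 + f * t1, b1 - f * s1, ?_⟩
    apply mul_left_cancel₀ hX
    rw [← hab]
    linear_combination (-S) * ha1 - T * hb1 - S * hfa - T * hb0 - f * S * ht1 + f * T * hs1 + f * T * h0
  · rw [Ideal.mem_span_pair]
    refine ⟨a1 + e * t1, b1 - e * s1, ?_⟩
    apply mul_left_cancel₀ hX
    rw [← hab]
    linear_combination (-S) * ha1 - T * hb1 - S * hae - T * he - e * S * ht1 + e * T * hs1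

theorem afbg {S T G : MvPolynomial (Fin 3) ℂ}
    (hS : S.IsHomogeneous 4) (hT : T.IsHomogeneous 6) (hG : G.IsHomogeneous 4)
    (h1 : ∀ x, MvPolynomial.eval x S = 0 → MvPolynomial.eval x T = 0 → x 2 = 0 → x = 0)
    (h2 : ∀ x, MvPolynomial.eval x S = 0 → MvPolynomial.eval x T = 0 →
      MvPolynomial.eval x (pderiv 0 S * pderiv 1 T - pderiv 1 S * pderiv 0 T) = 0 →
      MvPolynomial.eval x (pderiv 1 S * pderiv 2 T - pderiv 2 S * pderiv 1 T) = 0 →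
      MvPolynomial.eval x (pderiv 2 S * pderiv 0 T - pderiv 0 S * pderiv 2 T) = 0 → x = 0)
    (h3 : ∀ s t : ℂ, MvPolynomial.eval ![s, t, 1] S = 0 → MvPolynomial.eval ![s, t, 1] T = 0 →
      MvPolynomial.eval ![s, t, 1] G = 0) :
    ∃ κ : ℂ, ∀ x, MvPolynomial.eval x G = κ * MvPolynomial.eval x S := by
  obtain ⟨N, hN⟩ := exists_pow_w hS hT hG h2 h3
  have hmem : G ∈ Ideal.span {S, T} := by
    induction N with
    | zero => simpa using hN
    | succ n ih =>
      apply ih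
      apply descend_w h1
      rw [← mul_assoc, ← pow_succ']
      exact hN
  obtain ⟨a, b, hab⟩ := Ideal.mem_span_pair.mp hmem
  refine ⟨MvPolynomial.eval 0 a, fun x => ?_⟩
  have key : (fun _ : ℂ => MvPolynomial.eval x G) = fun l : ℂ =>
      MvPolynomial.eval (fun i => l * x i) a * MvPolynomial.eval x S +
      l ^ 2 * MvPolynomial.eval (fun i => l * x i) b * MvPolynomial.eval x T := by
    apply Continuous.ext_on (dense_compl_singleton (0 : ℂ)) continuous_const
    · have hc : ∀ q : MvPolynomial (Fin 3) ℂ, Continuous fun l : ℂ =>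
          MvPolynomial.eval (fun i => l * x i) q := fun q =>
        (MvPolynomial.continuous_eval q).comp (by fun_prop)
      exact ((hc a).mul continuous_const).add (((continuous_pow 2).mul (hc b)).mul continuous_const)
    · intro l hl
      have hl : l ≠ 0 := hl
      have := congrArg (MvPolynomial.eval (fun i => l * x i)) hab
      rw [map_add, map_mul, map_mul, eval_smul_homog hS, eval_smul_homog hT, eval_smul_homog hG] at this
      apply mul_left_cancel₀ (pow_ne_zero 4 hl)
      linear_combination -this
  have := congrFun key 0
  simp only [zero_mul] at this
  rw [this]
  have h0 : MvPolynomial.eval (fun _ => 0) a = MvPolynomial.eval 0 a := rfl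
  rw [h0]; ring

theorem quart_coeffs {k0 k1 k2 k3 k4 : ℂ}
    (h : ∀ t : ℂ, k0 + k1 * t + k2 * t ^ 2 + k3 * t ^ 3 + k4 * t ^ 4 = 0) :
    k0 = 0 ∧ k1 = 0 ∧ k2 = 0 ∧ k3 = 0 ∧ k4 = 0 := by
  have h1 : ![k0, k1, k2, k3, k4] = 0 := by
    by_contra hne
    apply quart_ne_zero hne
    apply Polynomial.funext
    intro t
    simpa [quart] using h t
  have e := fun i => congrFun h1 i
  exact ⟨e 0, e 1, e 2, e 3, e 4⟩

/-- The equations controlling the recovery of a normalized quartic. -/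
def req {R : Type*} [CommRing R] (θ : Fin 12 → R) (x : Fin 4 → R) : Fin 5 → R :=
  ![x 2 * (3 * θ 5 * x 0 - 12 * θ 1 * x 1) - θ 4 * x 0 ^ 2 + 3 * θ 0 * x 0 * x 1
      - x 3 ^ 2 * (θ 4 ^ 2 - 3 * θ 0 * θ 7),
    x 2 * (4 * θ 8 * x 0 - 6 * θ 5 * x 1) - 3 * θ 7 * x 0 ^ 2 + 4 * θ 4 * x 0 * x 1
      - 3 * θ 0 * x 1 ^ 2 - x 3 ^ 2 * (θ 4 * θ 7 - 9 * θ 0 * θ 9),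
    x 2 * (3 * θ 10 * x 0 - 2 * θ 8 * x 1) - 6 * θ 9 * x 0 ^ 2 + 3 * θ 7 * x 0 * x 1
      - θ 4 * x 1 ^ 2 - x 3 ^ 2 * (θ 7 ^ 2 - 3 * θ 4 * θ 9),
    3 * θ 2 * x 3 ^ 2 * ((-3 * θ 0 * θ 10 + 12 * θ 1 * θ 9 + 2 * θ 4 * θ 8 - 3 * θ 5 * θ 7) * x 2
        - 2 * x 0 * (θ 4 * θ 7 - 9 * θ 0 * θ 9) + 4 * x 1 * (θ 4 ^ 2 - 3 * θ 0 * θ 7))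
      + x 2 ^ 2 * (-2 * x 0 * (θ 4 * θ 7 - 9 * θ 0 * θ 9) + 4 * x 1 * (θ 4 ^ 2 - 3 * θ 0 * θ 7))
      + θ 2 * (x 2 * (-18 * x 0 * x 1 * θ 5 + 6 * x 0 ^ 2 * θ 8 + 36 * θ 1 * x 1 ^ 2)
        - 18 * θ 0 * x 0 * x 1 ^ 2 + 12 * x 0 ^ 2 * x 1 * θ 4 - 6 * x 0 ^ 3 * θ 7),
    (3 * θ 5 * x 2 - θ 4 * x 0 + 3 * θ 0 * x 1) *
        ((-6 * θ 5 * x 2 - 3 * θ 0 * x 1) * (θ 7 ^ 2 - 3 * θ 4 * θ 9)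
          - (-2 * θ 8 * x 2 - θ 4 * x 1) * (θ 4 * θ 7 - 9 * θ 0 * θ 9))
      - (-12 * θ 1 * x 2) *
        ((4 * θ 8 * x 2 - 3 * θ 7 * x 0 + 4 * θ 4 * x 1) * (θ 7 ^ 2 - 3 * θ 4 * θ 9)
          - (3 * θ 10 * x 2 - 6 * θ 9 * x 0 + 3 * θ 7 * x 1) * (θ 4 * θ 7 - 9 * θ 0 * θ 9))
      + (θ 4 ^ 2 - 3 * θ 0 * θ 7) *
        ((4 * θ 8 * x 2 - 3 * θ 7 * x 0 + 4 * θ 4 * x 1) * (-2 * θ 8 * x 2 - θ 4 * x 1)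
          - (3 * θ 10 * x 2 - 6 * θ 9 * x 0 + 3 * θ 7 * x 1) * (-6 * θ 5 * x 2 - 3 * θ 0 * x 1))]

theorem cramer3 {a b c a' b' c' a'' b'' c'' x y z : ℂ}
    (hd : a * (b' * c'' - b'' * c') - b * (a' * c'' - a'' * c') + c * (a' * b'' - a'' * b') ≠ 0)
    (h1 : a * x + b * y = c * z) (h2 : a' * x + b' * y = c' * z) (h3 : a'' * x + b'' * y = c'' * z) :
    x = 0 ∧ y = 0 ∧ z = 0 := by
  refine ⟨?_, ?_, ?_⟩
  · apply mul_left_cancel₀ hd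
    linear_combination (b' * c'' - b'' * c') * h1 - (b * c'' - b'' * c) * h2 + (b * c' - b' * c) * h3
  · apply mul_left_cancel₀ hd
    linear_combination -(a' * c'' - a'' * c') * h1 + (a * c'' - a'' * c) * h2 - (a * c' - a' * c) * h3
  · apply mul_left_cancel₀ hd
    linear_combination -(a' * b'' - a'' * b') * h1 + (a * b'' - a'' * b) * h2 - (a * b' - a' * b) * h3

theorem recover_coeffs {a b c c2 c3 d1 d2 e0 e1 f A B g C1 C2 C3 D0 D1 D2 E0 E1 F' : ℂ}
    (hc : c ≠ 0) (ha : a ≠ 0) (hg : g ≠ 0)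
    (hreq : ∀ x : Fin 4 → ℂ, (∀ j, req ![a, b, c, 0, c2, c3, 0, d1, d2, e0, e1, f] x j = 0) → x = 0)
    (s01 : a * c = A * g)
    (s10 : 12 * b * c = 12 * B * g - 3 * A * C1)
    (s02 : -3 * c * c2 = C1 ^ 2 - 3 * g * C2)
    (s11 : 9 * c * c3 = -6 * A * D0 + 9 * g * C3 - C1 * C2)
    (s20 : c2 ^ 2 - 3 * a * d1 = -3 * A * D1 + 12 * B * D0 - 3 * C1 * C3 + C2 ^ 2)
    (s03 : -3 * c * d1 = 2 * C1 * D0 - 3 * g * D1)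
    (s12 : 6 * c * d2 = 6 * g * D2 + C1 * D1 - 4 * C2 * D0)
    (s21 : c2 * d1 - 9 * a * e0 = -9 * A * E0 - 4 * C1 * D2 + C2 * D1 + 6 * C3 * D0)
    (s30 : -3 * a * e1 + 12 * b * e0 + 2 * c2 * d2 - 3 * c3 * d1 =
      -3 * A * E1 + 12 * B * E0 + 2 * C2 * D2 - 3 * C3 * D1)
    (s04 : -3 * c * e0 = D0 ^ 2 - 3 * g * E0)
    (s13 : 3 * c * e1 = 3 * g * E1 + 3 * C1 * E0 - 2 * D0 * D1)
    (s22 : d1 ^ 2 - 3 * c2 * e0 = -3 * C1 * E1 - 3 * C2 * E0 + 2 * D0 * D2 + D1 ^ 2)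
    (s31 : -12 * a * f + 3 * c2 * e1 + 3 * c3 * e0 - 2 * d1 * d2 =
      -12 * A * F' + 3 * C2 * E1 + 3 * C3 * E0 - 2 * D1 * D2) :
    ∃ u : ℂ, u ≠ 0 ∧ A = u * a ∧ B = u * b ∧ g = u * c ∧ C1 = 0 ∧ C2 = u * c2 ∧ C3 = u * c3 ∧
      D0 = 0 ∧ D1 = u * d1 ∧ D2 = u * d2 ∧ E0 = u * e0 ∧ E1 = u * e1 ∧ F' = u * f := by
  obtain ⟨r, hr⟩ : ∃ r, r = c / g := ⟨_, rfl⟩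
  obtain ⟨al, hal⟩ : ∃ al, al = C1 / (3 * g) := ⟨_, rfl⟩
  obtain ⟨be, hbe⟩ : ∃ be, be = D0 / (3 * g) := ⟨_, rfl⟩
  have ec : c = r * g := by rw [hr]; field_simp
  have eC1 : C1 = 3 * g * al := by rw [hal]; field_simp
  have eD0 : D0 = 3 * g * be := by rw [hbe]; field_simp
  have hr0 : r ≠ 0 := by rintro rfl; apply hc; rw [ec]; ring
  have eA : A = r * a := by
    apply mul_left_cancel₀ hg; rw [ec] at s01; linear_combination -s01
  have eB : B = r * b + 3 / 4 * r * a * al := by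
    apply mul_left_cancel₀ hg; rw [ec, eA, eC1] at s10; linear_combination (-1 / 12) * s10
  have eC2 : C2 = r * c2 + 3 * g * al ^ 2 := by
    apply mul_left_cancel₀ hg; rw [ec, eC1] at s02; linear_combination (1 / 3) * s02
  have eD1 : D1 = r * d1 + 6 * g * al * be := by
    apply mul_left_cancel₀ hg; rw [ec, eC1, eD0] at s03; linear_combination (1 / 3) * s03
  have eC3 : C3 = r * c3 + 2 * r * a * be + al * (r * c2 + 3 * g * al ^ 2) / 3 := by
    apply mul_left_cancel₀ hg; rw [ec, eC1, eD0, eA, eC2] at s11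
    linear_combination (-1 / 9) * s11
  have eD2 : D2 = r * d2 - al * (r * d1 + 6 * g * al * be) / 2
      + 2 * (r * c2 + 3 * g * al ^ 2) * be := by
    apply mul_left_cancel₀ hg; rw [ec, eC1, eD0, eD1, eC2] at s12
    linear_combination (-1 / 6) * s12
  have eE0 : E0 = r * e0 + 3 * g * be ^ 2 := by
    apply mul_left_cancel₀ hg; rw [ec, eD0] at s04
    linear_combination (1 / 3) * s04
  have eE1 : E1 = r * e1 - 3 * al * (r * e0 + 3 * g * be ^ 2)
      + 2 * be * (r * d1 + 6 * g * al * be) := by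
    apply mul_left_cancel₀ hg; rw [ec, eC1, eD0, eE0, eD1] at s13
    linear_combination (-1 / 3) * s13
  obtain ⟨om, hom⟩ : ∃ om : ℂ, om ^ 2 = (r ^ 2 - 1) / (3 * c) := by
    obtain ⟨z, hz⟩ := IsAlgClosed.exists_pow_nat_eq ((r ^ 2 - 1) / (3 * c)) (n := 2) (by norm_num)
    exact ⟨z, hz⟩
  have hr2 : r ^ 2 = 1 + 3 * c * om ^ 2 := by rw [hom]; field_simp; ring
  have q1 : (3 * c3 * al - 12 * b * be) - c2 * al ^ 2 + 3 * a * al * be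
      - om ^ 2 * (c2 ^ 2 - 3 * a * d1) = 0 := by
    apply mul_left_cancel₀ hc
    rw [eA, eD1, eB, eD0, eC1, eC3, eC2] at s20
    linear_combination (1 / 3) * s20 + (1 / 3) * (c2 ^ 2 - 3 * a * d1) * hr2 +
      (3 * c3 * al - 12 * b * be - c2 * al ^ 2 + 3 * a * al * be) * ec
  have q2 : (4 * d2 * al - 6 * c3 * be) - 3 * d1 * al ^ 2 + 4 * c2 * al * be - 3 * a * be ^ 2
      - om ^ 2 * (c2 * d1 - 9 * a * e0) = 0 := by
    apply mul_left_cancel₀ hc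
    rw [eA, eD1, eD2, eD0, eC1, eC3, eC2, eE0] at s21
    linear_combination (1 / 3) * s21 + (1 / 3) * (c2 * d1 - 9 * a * e0) * hr2 +
      (4 * d2 * al - 6 * c3 * be - 3 * d1 * al ^ 2 + 4 * c2 * al * be - 3 * a * be ^ 2) * ec
  have q3 : (3 * e1 * al - 2 * d2 * be) - 6 * e0 * al ^ 2 + 3 * d1 * al * be - c2 * be ^ 2
      - om ^ 2 * (d1 ^ 2 - 3 * c2 * e0) = 0 := by
    apply mul_left_cancel₀ hc
    rw [eD1, eD2, eD0, eC1, eC2, eE0, eE1] at s22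
    linear_combination (1 / 3) * s22 + (1 / 3) * (d1 ^ 2 - 3 * c2 * e0) * hr2 +
      (3 * e1 * al - 2 * d2 * be - 6 * e0 * al ^ 2 + 3 * d1 * al * be - c2 * be ^ 2) * ec
  have q4 : 3 * c * om ^ 2 * ((-3 * a * e1 + 12 * b * e0 + 2 * c2 * d2 - 3 * c3 * d1)
        - 2 * al * (c2 * d1 - 9 * a * e0) + 4 * be * (c2 ^ 2 - 3 * a * d1))
      + (-2 * al * (c2 * d1 - 9 * a * e0) + 4 * be * (c2 ^ 2 - 3 * a * d1))
      + c * ((-18 * al * be * c3 + 6 * al ^ 2 * d2 + 36 * b * be ^ 2)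
        - 18 * a * al * be ^ 2 + 12 * al ^ 2 * be * c2 - 6 * al ^ 3 * d1) = 0 := by
    rw [eA, eB, eD1, eD2, eC2, eC3, eE0, eE1] at s30
    linear_combination -s30 - ((-3 * a * e1 + 12 * b * e0 + 2 * c2 * d2 - 3 * c3 * d1)
        - 2 * al * (c2 * d1 - 9 * a * e0) + 4 * be * (c2 ^ 2 - 3 * a * d1)) * hr2 +
      ((-18 * al * be * c3 + 6 * al ^ 2 * d2 + 36 * b * be ^ 2)
        - 18 * a * al * be ^ 2 + 12 * al ^ 2 * be * c2 - 6 * al ^ 3 * d1) * ec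
  have hdet : req ![a, b, c, 0, c2, c3, 0, d1, d2, e0, e1, f] ![al, be, 1, om] 4 ≠ 0 := by
    intro h4
    have hx := hreq ![al, be, 1, om] (by
      intro j
      fin_cases j
      · simp only [req, Fin.zero_eta, Matrix.cons_val]; linear_combination q1
      · simp only [req, Fin.mk_one, Matrix.cons_val]; linear_combination q2
      · simp only [req, Fin.reduceFinMk, Matrix.cons_val]; linear_combination q3
      · simp only [req, Fin.reduceFinMk, Matrix.cons_val]; linear_combination q4
      · exact h4)
    have := congrFun hx 2
    simp at this
  simp only [req, Matrix.cons_val, mul_one] at hdet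
  obtain ⟨z1, z2, z3⟩ := cramer3 (x := al) (y := be) (z := om ^ 2) hdet
    (by linear_combination q1) (by linear_combination q2) (by linear_combination q3)
  rw [z3] at hr2
  have hrr : r ^ 2 = 1 := by rw [hr2]; ring
  refine ⟨r, hr0, eA, ?_, ?_, ?_, ?_, ?_, ?_, ?_, ?_, ?_, ?_, ?_⟩
  · rw [eB, z1]; ring
  · rw [ec]; linear_combination (-g) * hrr
  · rw [eC1, z1]; ring
  · rw [eC2, z1]; ring
  · rw [eC3, z1, z2]; ring
  · rw [eD0, z2]; ring
  · rw [eD1, z1]; ring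
  · rw [eD2, z1, z2]; ring
  · rw [eE0, z2]; ring
  · rw [eE1, z1, z2]; ring
  · apply mul_left_cancel₀ (mul_ne_zero hr0 ha)
    rw [eA, eD1, eD2, eC2, eC3, eE0, eE1, z1, z2] at s31
    linear_combination (1 / 12) * s31 + (-(1 / 12) * (3 * c2 * e1 + 3 * c3 * e0 - 2 * d1 * d2)
      - a * f + (1 / 12) * (3 * c2 * e1 + 3 * c3 * e0 - 2 * d1 * d2) * 2) * hrr

theorem tern_coeffs (D : Fin 5 → Fin 5 → ℂ)
    (h : ∀ s t : ℂ, ∑ i : Fin 5, ∑ j : Fin 5, D i j * s ^ (i : ℕ) * t ^ (j : ℕ) = 0) :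
    ∀ i j, D i j = 0 := by
  have h1 : ∀ t : ℂ, ∀ i, ∑ j : Fin 5, D i j * t ^ (j : ℕ) = 0 := by
    intro t
    have := quart_coeffs (k0 := ∑ j : Fin 5, D 0 j * t ^ (j : ℕ))
      (k1 := ∑ j : Fin 5, D 1 j * t ^ (j : ℕ)) (k2 := ∑ j : Fin 5, D 2 j * t ^ (j : ℕ))
      (k3 := ∑ j : Fin 5, D 3 j * t ^ (j : ℕ)) (k4 := ∑ j : Fin 5, D 4 j * t ^ (j : ℕ)) (by
        intro s
        have := h s t
        simp only [Fin.sum_univ_five] at this ⊢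
        simp only [Fin.coe_ofNat_eq_mod, Nat.reduceMod] at this ⊢
        linear_combination this)
    obtain ⟨z0, z1, z2, z3, z4⟩ := this
    intro i
    fin_cases i
    exacts [z0, z1, z2, z3, z4]
  intro i
  have := quart_coeffs (k0 := D i 0) (k1 := D i 1) (k2 := D i 2) (k3 := D i 3) (k4 := D i 4) (by
    intro t
    have := h1 t i
    rw [Fin.sum_univ_five] at this
    simp only [Fin.coe_ofNat_eq_mod, Nat.reduceMod] at this
    linear_combination this)
  obtain ⟨z0, z1, z2, z3, z4⟩ := this
  intro j
  fin_cases j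
  exacts [z0, z1, z2, z3, z4]

theorem recover {θ τ : Fin 12 → ℂ} (h3 : θ 3 = 0) (h6 : θ 6 = 0) (h0 : θ 0 ≠ 0) (h2 : θ 2 ≠ 0)
    (h2' : τ 2 ≠ 0) (hreq : ∀ x : Fin 4 → ℂ, (∀ j, req θ x j = 0) → x = 0)
    (hS : ∀ s t : ℂ, MvPolynomial.eval ![s, t, 1] (gS τ) = MvPolynomial.eval ![s, t, 1] (gS θ)) :
    ∃ u : ℂ, u ≠ 0 ∧ ∀ i, τ i = u * θ i := by
  have hz := tern_coeffs (![![0,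
      (-3 * τ 0 * τ 2) - (-3 * θ 0 * θ 2),
      (-3 * τ 2 * τ 4 + τ 3 ^ 2) - (-3 * θ 2 * θ 4),
      (-3 * τ 2 * τ 7 + 2 * τ 3 * τ 6) - (-3 * θ 2 * θ 7),
      (-3 * τ 2 * τ 9 + τ 6 ^ 2) - (-3 * θ 2 * θ 9)],
    ![(-3 * τ 0 * τ 3 + 12 * τ 1 * τ 2) - (12 * θ 1 * θ 2),
      (-6 * τ 0 * τ 6 + 9 * τ 2 * τ 5 - τ 3 * τ 4) - (9 * θ 2 * θ 5),
      (6 * τ 2 * τ 8 + τ 3 * τ 7 - 4 * τ 4 * τ 6) - (6 * θ 2 * θ 8),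
      (3 * τ 2 * τ 10 + 3 * τ 3 * τ 9 - 2 * τ 6 * τ 7) - (3 * θ 2 * θ 10),
      0],
    ![(-3 * τ 0 * τ 7 + 12 * τ 1 * τ 6 - 3 * τ 3 * τ 5 + τ 4 ^ 2) - (-3 * θ 0 * θ 7 + θ 4 ^ 2),
      (-9 * τ 0 * τ 9 - 4 * τ 3 * τ 8 + τ 4 * τ 7 + 6 * τ 5 * τ 6) - (-9 * θ 0 * θ 9 + θ 4 * θ 7),
      (-3 * τ 3 * τ 10 - 3 * τ 4 * τ 9 + 2 * τ 6 * τ 8 + τ 7 ^ 2) - (-3 * θ 4 * θ 9 + θ 7 ^ 2),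
      0,
      0],
    ![(-3 * τ 0 * τ 10 + 12 * τ 1 * τ 9 + 2 * τ 4 * τ 8 - 3 * τ 5 * τ 7) - (-3 * θ 0 * θ 10 + 12 * θ 1 * θ 9 + 2 * θ 4 * θ 8 - 3 * θ 5 * θ 7),
      (-12 * τ 0 * τ 11 + 3 * τ 4 * τ 10 + 3 * τ 5 * τ 9 - 2 * τ 7 * τ 8) - (-12 * θ 0 * θ 11 + 3 * θ 4 * θ 10 + 3 * θ 5 * θ 9 - 2 * θ 7 * θ 8),
      0,
      0,
      0],
    ![(12 * τ 1 * τ 11 - 3 * τ 5 * τ 10 + τ 8 ^ 2) - (12 * θ 1 * θ 11 - 3 * θ 5 * θ 10 + θ 8 ^ 2),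
      0,
      0,
      0,
      0]]) (by
    intro s t
    have := hS s t
    simp only [gS, map_add, eval_tm, h3, h6, Matrix.cons_val] at this
    simp only [Fin.sum_univ_five, Matrix.cons_val, Fin.coe_ofNat_eq_mod, Nat.reduceMod]
    linear_combination this)
  have hθ : ![θ 0, θ 1, θ 2, 0, θ 4, θ 5, 0, θ 7, θ 8, θ 9, θ 10, θ 11] = θ := by
    funext i
    fin_cases i <;> simp [h3, h6]
  obtain ⟨u, hu, r0, r1, r2, r3, r4, r5, r6, r7, r8, r9, r10, r11⟩ := recover_coeffs
    (a := θ 0) (b := θ 1) (c := θ 2) (c2 := θ 4) (c3 := θ 5) (d1 := θ 7) (d2 := θ 8) (e0 := θ 9)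
    (e1 := θ 10) (f := θ 11) (A := τ 0) (B := τ 1) (g := τ 2) (C1 := τ 3) (C2 := τ 4) (C3 := τ 5)
    (D0 := τ 6) (D1 := τ 7) (D2 := τ 8) (E0 := τ 9) (E1 := τ 10) (F' := τ 11)
    h2 h0 h2' (by rw [hθ]; exact hreq)
    (by have := hz 0 1; simp only [Matrix.cons_val] at this; linear_combination (1 / 3) * this)
    (by have := hz 1 0; simp only [Matrix.cons_val] at this; linear_combination -this)
    (by have := hz 0 2; simp only [Matrix.cons_val] at this; linear_combination -this)
    (by have := hz 1 1; simp only [Matrix.cons_val] at this; linear_combination -this)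
    (by have := hz 2 0; simp only [Matrix.cons_val] at this; linear_combination -this)
    (by have := hz 0 3; simp only [Matrix.cons_val] at this; linear_combination -this)
    (by have := hz 1 2; simp only [Matrix.cons_val] at this; linear_combination -this)
    (by have := hz 2 1; simp only [Matrix.cons_val] at this; linear_combination -this)
    (by have := hz 3 0; simp only [Matrix.cons_val] at this; linear_combination -this)
    (by have := hz 0 4; simp only [Matrix.cons_val] at this; linear_combination -this)
    (by have := hz 1 3; simp only [Matrix.cons_val] at this; linear_combination -this)
    (by have := hz 2 2; simp only [Matrix.cons_val] at this; linear_combination -this)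
    (by have := hz 3 1; simp only [Matrix.cons_val] at this; linear_combination -this)
  refine ⟨u, hu, fun i => ?_⟩
  fin_cases i
  exacts [r0, r1, r2, by simpa [h3] using r3, r4, r5, by simpa [h6] using r6, r7, r8, r9, r10, r11]

theorem pderiv0_tm {R : Type*} [CommRing R] (c : R) (i j k : ℕ) :
    pderiv 0 (tm c i j k) = tm (i * c) (i - 1) j k := by
  simp [tm, Derivation.leibniz, pderiv_X, Derivation.leibniz_pow]
  ring

theorem pderiv1_tm {R : Type*} [CommRing R] (c : R) (i j k : ℕ) :
    pderiv 1 (tm c i j k) = tm (j * c) i (j - 1) k := by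
  simp [tm, Derivation.leibniz, pderiv_X, Derivation.leibniz_pow]
  ring

theorem pderiv2_tm {R : Type*} [CommRing R] (c : R) (i j k : ℕ) :
    pderiv 2 (tm c i j k) = tm (k * c) i j (k - 1) := by
  simp [tm, Derivation.leibniz, pderiv_X, Derivation.leibniz_pow]
  ring

theorem pderiv0_gS (θ : Fin 12 → ℂ) (s t : ℂ) (hk : kk θ s t = 0) :
    MvPolynomial.eval ![s, t, 1] (pderiv 0 (gS θ)) = 0 := by
  have : MvPolynomial.eval ![s, t, 1] (pderiv 0 (gS θ)) =
      12 * ((θ 2 + 2 * θ 6 * s + 3 * θ 9 * s ^ 2 + 4 * θ 11 * s ^ 3) * kk θ s t 4 +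
      kk θ s t 0 * (0)) -
      3 * ((θ 3 + 2 * θ 6 * t + 2 * θ 7 * s + 6 * θ 9 * s * t + 3 * θ 10 * s ^ 2 + 12 * θ 11 * s ^ 2 * t) * kk θ s t 3 +
      kk θ s t 1 * (θ 5 + 2 * θ 8 * t + 3 * θ 10 * t ^ 2 + 4 * θ 11 * t ^ 3)) + 2 * kk θ s t 2 * (θ 4 + 2 * θ 7 * t + 2 * θ 8 * s + 3 * θ 9 * t ^ 2 + 6 * θ 10 * s * t + 12 * θ 11 * s * t ^ 2) := by
    simp only [gS, map_add, pderiv0_tm, eval_tm, kk, Matrix.cons_val, Nat.cast_ofNat, Nat.cast_zero,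
      Nat.cast_one, Nat.reduceSub]
    ring
  rw [this, hk]
  simp

theorem pderiv1_gS (θ : Fin 12 → ℂ) (s t : ℂ) (hk : kk θ s t = 0) :
    MvPolynomial.eval ![s, t, 1] (pderiv 1 (gS θ)) = 0 := by
  have : MvPolynomial.eval ![s, t, 1] (pderiv 1 (gS θ)) =
      12 * ((0) * kk θ s t 4 +
      kk θ s t 0 * (θ 5 + 2 * θ 8 * t + 3 * θ 10 * t ^ 2 + 4 * θ 11 * t ^ 3)) -
      3 * ((θ 2 + 2 * θ 6 * s + 3 * θ 9 * s ^ 2 + 4 * θ 11 * s ^ 3) * kk θ s t 3 +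
      kk θ s t 1 * (θ 4 + 2 * θ 7 * t + 2 * θ 8 * s + 3 * θ 9 * t ^ 2 + 6 * θ 10 * s * t + 12 * θ 11 * s * t ^ 2)) + 2 * kk θ s t 2 * (θ 3 + 2 * θ 6 * t + 2 * θ 7 * s + 6 * θ 9 * s * t + 3 * θ 10 * s ^ 2 + 12 * θ 11 * s ^ 2 * t) := by
    simp only [gS, map_add, pderiv1_tm, eval_tm, kk, Matrix.cons_val, Nat.cast_ofNat, Nat.cast_zero,
      Nat.cast_one, Nat.reduceSub]
    ring
  rw [this, hk]
  simp

/-- Smoothness of the scheme `S = T = 0`. -/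
def NoSing (θ : Fin 12 → ℂ) : Prop :=
  ∀ x, MvPolynomial.eval x (gS θ) = 0 → MvPolynomial.eval x (gT θ) = 0 →
    MvPolynomial.eval x (pderiv 0 (gS θ) * pderiv 1 (gT θ) - pderiv 1 (gS θ) * pderiv 0 (gT θ)) = 0 →
    MvPolynomial.eval x (pderiv 1 (gS θ) * pderiv 2 (gT θ) - pderiv 2 (gS θ) * pderiv 1 (gT θ)) = 0 →
    MvPolynomial.eval x (pderiv 2 (gS θ) * pderiv 0 (gT θ) - pderiv 0 (gS θ) * pderiv 2 (gT θ)) = 0 →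
    x = 0

/-- No common zero of `S` and `T` at infinity. -/
def NoInf (θ : Fin 12 → ℂ) : Prop :=
  ∀ x, MvPolynomial.eval x (gS θ) = 0 → MvPolynomial.eval x (gT θ) = 0 → x 2 = 0 → x = 0

theorem kk_ne_zero {θ : Fin 12 → ℂ} {s t : ℂ} (hE : NoSing θ)
    (hS : MvPolynomial.eval ![s, t, 1] (gS θ) = 0)
    (hT : MvPolynomial.eval ![s, t, 1] (gT θ) = 0) : kk θ s t ≠ 0 := by
  intro hk
  have h0 := pderiv0_gS θ s t hk
  have h1 := pderiv1_gS θ s t hk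
  have h2 := euler_at (gS_hom θ) hS
  rw [h0, h1] at h2
  simp only [Matrix.cons_val, mul_zero, zero_add, one_mul] at h2
  have := hE _ hS hT (by simp [h0, h1]) (by simp [h1, h2]) (by simp [h0, h2])
  have := congrFun this 2
  simp at this

theorem gS_smul (c : ℂ) (θ : Fin 12 → ℂ) (x : Fin 3 → ℂ) :
    MvPolynomial.eval x (gS fun i => c * θ i) = c ^ 2 * MvPolynomial.eval x (gS θ) := by
  simp only [gS, map_add, eval_tm]
  ring

theorem gS_ne {τ : Fin 12 → ℂ} (h2 : τ 2 ≠ 0) (h01 : τ 0 ≠ 0 ∨ τ 1 ≠ 0)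
    (h : ∀ x, MvPolynomial.eval x (gS τ) = 0) : False := by
  have e0 := (quart_coeffs (k0 := 0) (k1 := -3 * τ 0 * τ 2) (k2 := -3 * τ 2 * τ 4 + τ 3 ^ 2)
    (k3 := -3 * τ 2 * τ 7 + 2 * τ 3 * τ 6) (k4 := -3 * τ 2 * τ 9 + τ 6 ^ 2) (by
      intro t
      have := h ![0, t, 1]
      simp only [gS, map_add, eval_tm, Matrix.cons_val] at this
      linear_combination this)).2.1
  have e1 := (quart_coeffs (k0 := 0) (k1 := -3 * τ 0 * τ 3 + 12 * τ 1 * τ 2)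
    (k2 := -3 * τ 0 * τ 7 + 12 * τ 1 * τ 6 - 3 * τ 3 * τ 5 + τ 4 ^ 2)
    (k3 := -3 * τ 0 * τ 10 + 12 * τ 1 * τ 9 + 2 * τ 4 * τ 8 - 3 * τ 5 * τ 7) (k4 := 12 * τ 1 * τ 11 - 3 * τ 5 * τ 10 + τ 8 ^ 2) (by
      intro s
      have := h ![s, 0, 1]
      simp only [gS, map_add, eval_tm, Matrix.cons_val] at this
      linear_combination this)).2.1
  have f0 : τ 0 = 0 := by
    have : τ 0 * τ 2 = 0 := by linear_combination (-1 / 3) * e0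
    exact (mul_eq_zero.mp this).resolve_right h2
  have f1 : τ 1 = 0 := by
    rw [f0] at e1
    have : τ 1 * τ 2 = 0 := by linear_combination (1 / 12) * e1
    exact (mul_eq_zero.mp this).resolve_right h2
  rcases h01 with h | h
  · exact h f0
  · exact h f1

theorem core {θ τ : Fin 12 → ℂ} (h3 : θ 3 = 0) (h6 : θ 6 = 0) (h0 : θ 0 ≠ 0) (h2 : θ 2 ≠ 0)
    (h2' : τ 2 ≠ 0) (h01' : τ 0 ≠ 0 ∨ τ 1 ≠ 0)
    (hreq : ∀ x : Fin 4 → ℂ, (∀ j, req θ x j = 0) → x = 0) (hE : NoSing θ) (hI : NoInf θ)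
    (hinf : ∀ s t, inflMultLine (gQ θ) ![1, 0, s] ![0, 1, t] =
      inflMultLine (gQ τ) ![1, 0, s] ![0, 1, t]) :
    ∃ u : ℂ, u ≠ 0 ∧ ∀ i, τ i = u * θ i := by
  obtain ⟨κ, hκ⟩ := afbg (gS_hom θ) (gT_hom θ) (gS_hom τ) hI hE (by
    intro s t hS hT
    apply gS_zero_of_infl
    rw [← hinf]
    exact infl_of_zero h3 h6 (kk_ne_zero hE hS hT) hS hT)
  have hκ0 : κ ≠ 0 := by
    rintro rfl
    exact gS_ne h2' h01' fun x => by rw [hκ]; ring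
  obtain ⟨σ, hσ⟩ := IsAlgClosed.exists_pow_nat_eq κ (n := 2) (by norm_num)
  have hσ0 : σ ≠ 0 := by
    rintro rfl
    apply hκ0; rw [← hσ]; norm_num
  obtain ⟨u, hu, h⟩ := recover (τ := fun i => σ⁻¹ * τ i) h3 h6 h0 h2
    (mul_ne_zero (inv_ne_zero hσ0) h2') hreq (by
      intro s t
      rw [gS_smul, hκ, ← hσ]
      field_simp)
  refine ⟨σ * u, mul_ne_zero hσ0 hu, fun i => ?_⟩
  rw [mul_assoc, ← h i]
  field_simp

/-- The generic parameters. -/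
def gen : Fin 12 → MvPolynomial (Fin 12) ℂ := fun i => MvPolynomial.X i

theorem eval_gen (θ : Fin 12 → ℂ) : (fun i => MvPolynomial.eval θ (gen i)) = θ := by
  funext i; simp [gen]

theorem homog_zero {n : ℕ} {F : MvPolynomial (Fin 3) ℂ} (hF : F.IsHomogeneous n) (x : Fin 3 → ℂ)
    (l : ℂ) (h : MvPolynomial.eval x F = 0) : MvPolynomial.eval (fun i => l * x i) F = 0 := by
  rw [eval_smul_homog hF, h, mul_zero]

/-- The three partial derivatives of the quartic have no common zero. -/
def NoCrit (θ : Fin 12 → ℂ) : Prop :=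
  ∀ x : Fin 3 → ℂ, (∀ j, MvPolynomial.eval x (pderiv j (gQ θ)) = 0) → x = 0

theorem klein_noCrit : NoCrit ![1, 0, 1, 0, 0, 0, 0, 0, 0, 0, 1, 0] := by
  intro x hx
  have e0 := hx 0
  have e1 := hx 1
  have e2 := hx 2
  simp only [gQ, map_add, pderiv0_tm, pderiv1_tm, pderiv2_tm, eval_tm, Matrix.cons_val, Nat.cast_ofNat, Nat.cast_zero,
      Nat.cast_one, Nat.reduceSub] at e0 e1 e2
  set u := x 0
  set v := x 1
  set w := x 2
  have f0 : 3 * u ^ 2 * w + v ^ 3 = 0 := by linear_combination e0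
  have f1 : 3 * u * v ^ 2 + w ^ 3 = 0 := by linear_combination e1
  have f2 : u ^ 3 + 3 * v * w ^ 2 = 0 := by linear_combination e2
  have g0 : u * v ^ 3 = 0 := by
    linear_combination (1/28) * (u * f0 + 9 * v * f1 - 3 * w * f2)
  have hu : u = 0 ∨ v = 0 := by
    rcases mul_eq_zero.mp g0 with h | h
    · exact Or.inl h
    · exact Or.inr (pow_eq_zero_iff (by norm_num) |>.mp h)
  have key : u = 0 ∧ v = 0 ∧ w = 0 := by
    rcases hu with h | h <;> rw [h] at f0 f1 f2
    · have hv : v = 0 := by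
        apply (pow_eq_zero_iff (n := 3) (by norm_num)).mp; linear_combination f0
      have hw : w = 0 := by
        apply (pow_eq_zero_iff (n := 3) (by norm_num)).mp; linear_combination f1
      exact ⟨h, hv, hw⟩
    · have hv : u = 0 := by
        apply (pow_eq_zero_iff (n := 3) (by norm_num)).mp; linear_combination f2
      have hw : w = 0 := by
        apply (pow_eq_zero_iff (n := 3) (by norm_num)).mp; linear_combination f1
      exact ⟨hv, h, hw⟩
  funext i
  fin_cases i
  · exact key.1
  · exact key.2.1
  · exact key.2.2

theorem noCrit_open : ∃ Ψ : MvPolynomial (Fin 12) ℂ,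
    MvPolynomial.eval ![1, 0, 1, 0, 0, 0, 0, 0, 0, 0, 1, 0] Ψ ≠ 0 ∧
    ∀ θ, MvPolynomial.eval θ Ψ ≠ 0 → NoCrit θ := by
  have hm : ∀ θ j, MvPolynomial.map (MvPolynomial.eval θ) (pderiv j (gQ gen)) = pderiv j (gQ θ) := by
    intro θ j
    rw [← pderiv_map, map_gQ, eval_gen]
  obtain ⟨Ψ, h1, h2⟩ := elim (fun j : Fin 3 => pderiv j (gQ gen))
    (by
      intro j θ x l h
      simp only [hm] at h ⊢
      exact homog_zero (gQ_hom θ).pderiv x l h) ![1, 0, 1, 0, 0, 0, 0, 0, 0, 0, 1, 0]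
    (by
      intro x hx
      simp only [hm] at hx
      exact klein_noCrit x hx)
  refine ⟨Ψ, h1, fun θ h x hx => h2 θ h x ?_⟩
  simpa only [hm] using hx

theorem klein_noSing : NoSing ![1, 0, 1, 0, 0, 0, 0, 0, 0, 0, 1, 0] := by
  intro x e0 e1 e2 e3 e4
  simp only [gS, gT, map_add, map_sub, map_mul, pderiv0_tm, pderiv1_tm, pderiv2_tm, eval_tm, Matrix.cons_val, Nat.cast_ofNat, Nat.cast_zero,
      Nat.cast_one, Nat.reduceSub] at e0 e1 e2 e3 e4
  set u := x 0
  set v := x 1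
  set w := x 2
  have h0 : u * v ^ 3 - u ^ 3 * w - v * w ^ 3 = 0 := by linear_combination (1/3) * e0
  have h1 : u ^ 5 * v - u * w ^ 5 - v ^ 5 * w - 5 * u ^ 2 * v ^ 2 * w ^ 2 = 0 := by
    linear_combination (1/27) * e1
  have h2 : (35)*u^2*v^4*w^2 + (-14)*u^5*v^3*w^0 + (-5)*u^0*v^7*w^1 + (35)*u^4*v^1*w^3 + (-3)*u^7*v^0*w^1 + (-7)*u^1*v^2*w^5 + (-1)*u^0*v^0*w^8 = 0 := by
    linear_combination (1/81) * e2
  have h3 : (-35)*u^3*v^4*w^1 + (-35)*u^2*v^2*w^4 + (-3)*u^1*v^7*w^0 + (5)*u^1*v^0*w^7 + (-14)*u^0*v^5*w^3 + (-7)*u^5*v^1*w^2 + (1)*u^8*v^0*w^0 = 0 := by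
    linear_combination (1/81) * e3
  have h4 : (-35)*u^4*v^2*w^2 + (-5)*u^7*v^1*w^0 + (-14)*u^3*v^0*w^5 + (35)*u^1*v^3*w^4 + (3)*u^0*v^1*w^7 + (7)*u^2*v^5*w^1 + (1)*u^0*v^8*w^0 = 0 := by
    linear_combination (1/81) * e4
  clear e0 e1 e2 e3 e4
  have hu : u ^ 15 = 0 := by
    linear_combination ((54/49)*u^0*v^4*w^7+(-74419/343)*u^1*v^6*w^4+(-72903/343)*u^2*v^1*w^8+(45)*u^2*v^8*w^1+(-333212/343)*u^3*v^3*w^5+(48872/343)*u^4*v^5*w^2+(7487/343)*u^5*v^0*w^6+(27206/343)*u^6*v^2*w^3+(-42)*u^7*v^4*w^0+(-7)*u^9*v^1*w^1)*h0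
      + ((1924/343)*u^0*v^0*w^9+(11510/343)*u^0*v^7*w^2+(89021/343)*u^1*v^2*w^6+(-166624/343)*u^2*v^4*w^3+(45)*u^3*v^6*w^0)*h1
      + ((-2302/343)*u^0*v^5*w^2+(-1924/343)*u^1*v^0*w^6+(-12270/343)*u^2*v^2*w^3)*h2
      + ((1)*u^7*v^0*w^0)*h3
  have hv : v ^ 15 = 0 := by
    linear_combination ((-54/49)*u^0*v^0*w^11+(16531/343)*u^0*v^7*w^4+(1728/49)*u^1*v^2*w^8+(-16658/343)*u^1*v^9*w^1+(62896/343)*u^2*v^4*w^5+(-32378/343)*u^3*v^6*w^2+(-108/49)*u^4*v^1*w^6+(-6816/343)*u^5*v^3*w^3+(2178/343)*u^6*v^5*w^0)*h0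
      + ((-17392/343)*u^0*v^3*w^6+(33834/343)*u^1*v^5*w^3+(54/49)*u^2*v^0*w^7+(-10627/343)*u^2*v^7*w^0)*h1
      + ((54/49)*u^0*v^1*w^6+(2272/343)*u^1*v^3*w^3+(-726/343)*u^2*v^5*w^0)*h2
      + ((1)*u^0*v^7*w^0)*h4
  have hw : w ^ 15 = 0 := by
    linear_combination ((-15644/343)*u^0*v^6*w^5+(-38)*u^1*v^1*w^9+(31084/343)*u^1*v^8*w^2+(-63908/343)*u^2*v^3*w^6+(33552/343)*u^3*v^5*w^3+(3)*u^4*v^0*w^7+(-1026/49)*u^4*v^7*w^0+(6906/343)*u^5*v^2*w^4+(-2280/343)*u^6*v^4*w^1)*h0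
      + ((17737/343)*u^0*v^2*w^7+(270/49)*u^0*v^9*w^0+(-34462/343)*u^1*v^4*w^4+(4604/343)*u^2*v^6*w^1)*h1
      + ((-1)*u^0*v^0*w^7+(-54/49)*u^0*v^7*w^0+(-2302/343)*u^1*v^2*w^4+(760/343)*u^2*v^4*w^1)*h2
  rw [pow_eq_zero_iff (by norm_num)] at hu hv hw
  funext i
  fin_cases i
  · exact hu
  · exact hv
  · exact hw

theorem noSing_open : ∃ Ψ : MvPolynomial (Fin 12) ℂ,
    MvPolynomial.eval ![1, 0, 1, 0, 0, 0, 0, 0, 0, 0, 1, 0] Ψ ≠ 0 ∧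
    ∀ θ, MvPolynomial.eval θ Ψ ≠ 0 → NoSing θ := by
  let mm : ∀ {R : Type} [CommRing R], (Fin 12 → R) → Fin 3 → Fin 3 → MvPolynomial (Fin 3) R :=
    fun θ i j => pderiv i (gS θ) * pderiv j (gT θ) - pderiv j (gS θ) * pderiv i (gT θ)
  have hm : ∀ θ i j, MvPolynomial.map (MvPolynomial.eval θ) (mm gen i j) = mm θ i j := by
    intro θ i j
    simp only [mm, map_sub, map_mul]
    simp only [← pderiv_map, map_gS, map_gT, eval_gen]
  have hS : ∀ θ, MvPolynomial.map (MvPolynomial.eval θ) (gS gen) = gS θ := by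
    intro θ; rw [map_gS, eval_gen]
  have hT : ∀ θ, MvPolynomial.map (MvPolynomial.eval θ) (gT gen) = gT θ := by
    intro θ; rw [map_gT, eval_gen]
  have hmh : ∀ (θ : Fin 12 → ℂ) i j, (mm θ i j).IsHomogeneous 8 := by
    intro θ i j
    exact ((gS_hom θ).pderiv.mul (gT_hom θ).pderiv).sub ((gS_hom θ).pderiv.mul (gT_hom θ).pderiv)
  obtain ⟨Ψ, h1, h2⟩ := elim (n := 3) (fun j : Fin 5 =>
      ![gS gen, gT gen, mm gen 0 1, mm gen 1 2, mm gen 2 0] j)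
    (by
      intro j θ x l
      fin_cases j
      · simp only [Fin.zero_eta, Fin.mk_one, Fin.reduceFinMk, Matrix.cons_val, hS]
        exact homog_zero (gS_hom θ) x l
      · simp only [Fin.zero_eta, Fin.mk_one, Fin.reduceFinMk, Matrix.cons_val, hT]
        exact homog_zero (gT_hom θ) x l
      · simp only [Fin.zero_eta, Fin.mk_one, Fin.reduceFinMk, Matrix.cons_val, hm]
        exact homog_zero (hmh θ 0 1) x l
      · simp only [Fin.zero_eta, Fin.mk_one, Fin.reduceFinMk, Matrix.cons_val, hm]
        exact homog_zero (hmh θ 1 2) x l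
      · simp only [Fin.zero_eta, Fin.mk_one, Fin.reduceFinMk, Matrix.cons_val, hm]
        exact homog_zero (hmh θ 2 0) x l) ![1, 0, 1, 0, 0, 0, 0, 0, 0, 0, 1, 0]
    (by
      intro x hx
      have a0 := hx 0
      have a1 := hx 1
      have a2 := hx 2
      have a3 := hx 3
      have a4 := hx 4
      simp only [Matrix.cons_val, hS, hT, hm] at a0 a1 a2 a3 a4
      exact klein_noSing x a0 a1 a2 a3 a4)
  refine ⟨Ψ, h1, fun θ h x a0 a1 a2 a3 a4 => h2 θ h x ?_⟩
  intro j
  fin_cases j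
  · simpa only [Fin.zero_eta, Fin.mk_one, Fin.reduceFinMk, Matrix.cons_val, hS] using a0
  · simpa only [Fin.zero_eta, Fin.mk_one, Fin.reduceFinMk, Matrix.cons_val, hT] using a1
  · simpa only [Fin.zero_eta, Fin.mk_one, Fin.reduceFinMk, Matrix.cons_val, hm] using a2
  · simpa only [Fin.zero_eta, Fin.mk_one, Fin.reduceFinMk, Matrix.cons_val, hm] using a3
  · simpa only [Fin.zero_eta, Fin.mk_one, Fin.reduceFinMk, Matrix.cons_val, hm] using a4

theorem example_noInf : NoInf ![0, 0, 1, 0, 0, 0, 0, 0, 1, 0, 0, 1] := by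
  intro x e0 e1 hw
  simp only [gS, gT, map_add, eval_tm, Matrix.cons_val, hw] at e0 e1
  have hu : x 0 ^ 4 = 0 := by linear_combination e0
  rw [pow_eq_zero_iff (by norm_num)] at hu
  rw [hu] at e1
  have hv : x 1 ^ 6 = 0 := by linear_combination (-1/27) * e1
  rw [pow_eq_zero_iff (by norm_num)] at hv
  funext i
  fin_cases i
  · exact hu
  · exact hv
  · exact hw

theorem noInf_open : ∃ Ψ : MvPolynomial (Fin 12) ℂ,
    MvPolynomial.eval ![0, 0, 1, 0, 0, 0, 0, 0, 1, 0, 0, 1] Ψ ≠ 0 ∧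
    ∀ θ, MvPolynomial.eval θ Ψ ≠ 0 → NoInf θ := by
  have hS : ∀ θ, MvPolynomial.map (MvPolynomial.eval θ) (gS gen) = gS θ := by
    intro θ; rw [map_gS, eval_gen]
  have hT : ∀ θ, MvPolynomial.map (MvPolynomial.eval θ) (gT gen) = gT θ := by
    intro θ; rw [map_gT, eval_gen]
  obtain ⟨Ψ, h1, h2⟩ := elim (n := 3) (fun j : Fin 3 =>
      ![gS gen, gT gen, MvPolynomial.X 2] j)
    (by
      intro j θ x l
      fin_cases j
      · simp only [Fin.zero_eta, Fin.mk_one, Fin.reduceFinMk, Matrix.cons_val, hS]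
        exact homog_zero (gS_hom θ) x l
      · simp only [Fin.zero_eta, Fin.mk_one, Fin.reduceFinMk, Matrix.cons_val, hT]
        exact homog_zero (gT_hom θ) x l
      · simp only [Fin.zero_eta, Fin.mk_one, Fin.reduceFinMk, Matrix.cons_val, MvPolynomial.map_X, MvPolynomial.eval_X]
        intro h
        rw [h, mul_zero]) ![0, 0, 1, 0, 0, 0, 0, 0, 1, 0, 0, 1]
    (by
      intro x hx
      have a0 := hx 0
      have a1 := hx 1
      have a2 := hx 2
      simp only [Matrix.cons_val, hS, hT, MvPolynomial.map_X, MvPolynomial.eval_X] at a0 a1 a2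
      exact example_noInf x a0 a1 a2)
  refine ⟨Ψ, h1, fun θ h x a0 a1 a2 => h2 θ h x ?_⟩
  intro j
  fin_cases j
  · simpa only [Fin.zero_eta, Fin.mk_one, Fin.reduceFinMk, Matrix.cons_val, hS] using a0
  · simpa only [Fin.zero_eta, Fin.mk_one, Fin.reduceFinMk, Matrix.cons_val, hT] using a1
  · simpa only [Fin.zero_eta, Fin.mk_one, Fin.reduceFinMk, Matrix.cons_val, MvPolynomial.map_X, MvPolynomial.eval_X] using a2

/-- The auxiliary equations have only the trivial solution. -/
def NoReq (θ : Fin 12 → ℂ) : Prop := ∀ x : Fin 4 → ℂ, (∀ j, req θ x j = 0) → x = 0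

theorem example_noReq : NoReq ![1, 5/2, 1, 0, 0, 0, 0, 1, 3, 0, 0, 0] := by
  intro x hx
  have e0 := hx 0
  have e1 := hx 1
  have e2 := hx 2
  have e3 := hx 3
  have e4 := hx 4
  simp only [req, Matrix.cons_val] at e0 e1 e2 e3 e4
  set α := x 0
  set β := x 1
  set τ := x 2
  set ω := x 3
  have f1 : 12 * α * τ = 3 * (α ^ 2 + β ^ 2) := by linear_combination e1
  have f2 : β * (α - 4 * τ) = 0 := by linear_combination (1/12) * (e0 + 3 * e2)
  have hβ : β = 0 := by
    rcases mul_eq_zero.mp f2 with h | h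
    · exact h
    · have : β ^ 2 = 0 := by linear_combination (-1/3) * f1 - α * h
      exact (pow_eq_zero_iff (by norm_num)).mp this
  rw [hβ] at e0 e1 e2 e3 e4 f1
  have hω : ω = 0 := by
    have : ω ^ 2 = 0 := by linear_combination -e2
    exact (pow_eq_zero_iff (by norm_num)).mp this
  rw [hω] at e3
  have h2 : α * (4 * τ - α) = 0 := by linear_combination (1/3) * f1
  have key : τ = 0 ∧ α = 0 := by
    rcases mul_eq_zero.mp h2 with h | h
    · refine ⟨?_, h⟩
      rw [h] at e4
      have : τ ^ 2 = 0 := by linear_combination (1/576) * e4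
      exact (pow_eq_zero_iff (by norm_num)).mp this
    · have hα : α = 4 * τ := by linear_combination -h
      rw [hα] at e3
      have : τ ^ 3 = 0 := by linear_combination (-1/96) * e3
      have := (pow_eq_zero_iff (by norm_num)).mp this
      exact ⟨this, by rw [hα, this, mul_zero]⟩
  funext i
  fin_cases i
  · exact key.2
  · exact hβ
  · exact key.1
  · exact hω

theorem noReq_open : ∃ Ψ : MvPolynomial (Fin 12) ℂ,
    MvPolynomial.eval ![1, 5/2, 1, 0, 0, 0, 0, 1, 3, 0, 0, 0] Ψ ≠ 0 ∧
    ∀ θ, MvPolynomial.eval θ Ψ ≠ 0 → NoReq θ := by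
  have hm : ∀ (θ : Fin 12 → ℂ) (x : Fin 4 → ℂ) j, MvPolynomial.eval x (MvPolynomial.map (MvPolynomial.eval θ)
      (req (fun i => MvPolynomial.C (gen i)) MvPolynomial.X j)) = req θ x j := by
    intro θ x j
    fin_cases j <;>
      simp [req, gen]
  obtain ⟨Ψ, h1, h2⟩ := elim (fun j : Fin 5 => req (fun i => MvPolynomial.C (gen i)) MvPolynomial.X j)
    (by
      intro j θ x l h
      rw [hm] at h ⊢
      fin_cases j
      · simp only [Fin.zero_eta, Fin.mk_one, Fin.reduceFinMk, req, Matrix.cons_val] at h ⊢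
        linear_combination l ^ 2 * h
      · simp only [Fin.zero_eta, Fin.mk_one, Fin.reduceFinMk, req, Matrix.cons_val] at h ⊢
        linear_combination l ^ 2 * h
      · simp only [Fin.zero_eta, Fin.mk_one, Fin.reduceFinMk, req, Matrix.cons_val] at h ⊢
        linear_combination l ^ 2 * h
      · simp only [Fin.zero_eta, Fin.mk_one, Fin.reduceFinMk, req, Matrix.cons_val] at h ⊢
        linear_combination l ^ 3 * h
      · simp only [Fin.zero_eta, Fin.mk_one, Fin.reduceFinMk, req, Matrix.cons_val] at h ⊢
        linear_combination l ^ 2 * h) ![1, 5/2, 1, 0, 0, 0, 0, 1, 3, 0, 0, 0]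
    (by
      intro x hx
      simp only [hm] at hx
      exact example_noReq x hx)
  refine ⟨Ψ, h1, fun θ h x hx => h2 θ h x ?_⟩
  simpa only [hm] using hx

/-- Kill the two normalized coefficients. -/
def nrm {R : Type*} [CommRing R] (θ : Fin 12 → R) : Fin 12 → R :=
  fun i => if i = 3 ∨ i = 6 then 0 else θ i

theorem nrm_of {θ : Fin 12 → ℂ} (h3 : θ 3 = 0) (h6 : θ 6 = 0) : nrm θ = θ := by
  funext i
  unfold nrm
  split_ifs with h
  · rcases h with rfl | rfl
    · exact h3.symm
    · exact h6.symm
  · rfl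

theorem generic_normalized : ∃ Ψ : MvPolynomial (Fin 12) ℂ,
    (∃ θ : Fin 12 → ℂ, θ 3 = 0 ∧ θ 6 = 0 ∧ MvPolynomial.eval θ Ψ ≠ 0) ∧
    ∀ θ : Fin 12 → ℂ, MvPolynomial.eval θ Ψ ≠ 0 →
      θ 0 ≠ 0 ∧ θ 2 ≠ 0 ∧ NoCrit θ ∧ NoSing θ ∧ NoInf θ ∧ NoReq θ := by
  obtain ⟨Ψ1, a1, b1⟩ := noCrit_open
  obtain ⟨Ψ2, a2, b2⟩ := noSing_open
  obtain ⟨Ψ3, a3, b3⟩ := noInf_open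
  obtain ⟨Ψ4, a4, b4⟩ := noReq_open
  let Ψ := MvPolynomial.X 0 * MvPolynomial.X 2 * Ψ1 * Ψ2 * Ψ3 * Ψ4
  have hsub : ∀ (P : MvPolynomial (Fin 12) ℂ) θ,
      MvPolynomial.eval θ (MvPolynomial.aeval (nrm gen) P) = MvPolynomial.eval (nrm θ) P := by
    intro P θ
    rw [← MvPolynomial.coe_aeval_eq_eval, ← MvPolynomial.coe_aeval_eq_eval]
    simp only [RingHom.coe_coe]
    rw [← AlgHom.comp_apply, MvPolynomial.comp_aeval]
    congr 2
    funext i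
    simp only [nrm, gen]
    split_ifs <;> simp
  have hne : ∀ (P : MvPolynomial (Fin 12) ℂ) θ, θ 3 = 0 → θ 6 = 0 → MvPolynomial.eval θ P ≠ 0 →
      MvPolynomial.aeval (nrm gen) P ≠ 0 := by
    intro P θ h3 h6 h h'
    apply h
    rw [← nrm_of h3 h6, ← hsub, h', map_zero]
  have hΨ : MvPolynomial.aeval (nrm gen) Ψ ≠ 0 := by
    simp only [Ψ, map_mul]
    refine mul_ne_zero (mul_ne_zero (mul_ne_zero (mul_ne_zero (mul_ne_zero ?_ ?_) ?_) ?_) ?_) ?_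
    · exact hne _ (fun i => if i = 0 then 1 else 0) (by simp) (by simp) (by simp)
    · exact hne _ (fun i => if i = 2 then 1 else 0) (by simp) (by simp) (by simp)
    · exact hne _ _ (by simp) (by simp) a1
    · exact hne _ _ (by simp) (by simp) a2
    · exact hne _ _ (by simp) (by simp) a3
    · exact hne _ _ (by simp) (by simp) a4
  refine ⟨Ψ, ?_, ?_⟩
  · by_contra hcon
    push Not at hcon
    apply hΨ
    apply MvPolynomial.funext
    intro θ
    rw [hsub, map_zero]
    exact hcon _ (by simp [nrm]) (by simp [nrm])
  · intro θ h
    simp only [Ψ, map_mul, mul_ne_zero_iff, MvPolynomial.eval_X] at h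
    obtain ⟨⟨⟨⟨⟨h0, h2⟩, c1⟩, c2⟩, c3⟩, c4⟩ := h
    exact ⟨h0, h2, b1 θ c1, b2 θ c2, b3 θ c3, b4 θ c4⟩

/-- Linear substitution. -/
def lsub (N : Matrix (Fin 3) (Fin 3) ℂ) (F : MvPolynomial (Fin 3) ℂ) : MvPolynomial (Fin 3) ℂ :=
  MvPolynomial.aeval (fun i => ∑ j, MvPolynomial.C (N i j) * MvPolynomial.X j) F

theorem eval_lsub (N : Matrix (Fin 3) (Fin 3) ℂ) (F : MvPolynomial (Fin 3) ℂ) (x : Fin 3 → ℂ) :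
    MvPolynomial.eval x (lsub N F) = MvPolynomial.eval (N.mulVec x) F := by
  unfold lsub
  induction F using MvPolynomial.induction_on with
  | C a => simp
  | add p q hp hq => simp only [map_add, hp, hq]
  | mul_X p i hp =>
    simp only [map_mul, hp, MvPolynomial.aeval_X, MvPolynomial.eval_X, map_sum, MvPolynomial.eval_C]
    rfl

theorem lineRestrict_lsub (N : Matrix (Fin 3) (Fin 3) ℂ) (F : MvPolynomial (Fin 3) ℂ)
    (a b : Fin 3 → ℂ) :
    lineRestrict (lsub N F) a b = lineRestrict F (N.mulVec a) (N.mulVec b) := by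
  unfold lineRestrict lsub
  induction F using MvPolynomial.induction_on with
  | C a => simp
  | add p q hp hq => simp only [map_add, hp, hq]
  | mul_X p i hp =>
    simp only [map_mul, hp, MvPolynomial.aeval_X, map_sum, MvPolynomial.aeval_C]
    congr 1
    simp only [Matrix.mulVec, dotProduct, Fin.sum_univ_three, map_add, map_mul,
      Polynomial.algebraMap_eq]
    ring

theorem inflMultLine_lsub (N : Matrix (Fin 3) (Fin 3) ℂ) (F : MvPolynomial (Fin 3) ℂ)
    (a b : Fin 3 → ℂ) :
    inflMultLine (lsub N F) a b = inflMultLine F (N.mulVec a) (N.mulVec b) := by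
  simp only [inflMultLine, contactAt, lineRestrict_lsub]

theorem lsub_hom {N : Matrix (Fin 3) (Fin 3) ℂ} {F : MvPolynomial (Fin 3) ℂ} {n : ℕ}
    (hF : F.IsHomogeneous n) : (lsub N F).IsHomogeneous n := by
  have := hF.aeval (fun i => ∑ j, MvPolynomial.C (N i j) * MvPolynomial.X j) (n := 1) (by
    intro i
    apply MvPolynomial.IsHomogeneous.sum
    intro j _
    simpa using (MvPolynomial.isHomogeneous_C (Fin 3) (N i j)).mul
      (MvPolynomial.isHomogeneous_X ℂ j))
  rwa [one_mul] at this

theorem pderiv_lsub (N : Matrix (Fin 3) (Fin 3) ℂ) (F : MvPolynomial (Fin 3) ℂ) (x : Fin 3 → ℂ)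
    (j : Fin 3) : MvPolynomial.eval x (pderiv j (lsub N F)) =
      ∑ i, N i j * MvPolynomial.eval (N.mulVec x) (pderiv i F) := by
  induction F using MvPolynomial.induction_on with
  | C a => simp [lsub]
  | add p q hp hq =>
    have : lsub N (p + q) = lsub N p + lsub N q := by simp [lsub]
    rw [this]
    simp only [map_add, hp, hq, mul_add, Finset.sum_add_distrib]
  | mul_X p i hp =>
    have h1 : lsub N (p * MvPolynomial.X i) =
        lsub N p * ∑ j, MvPolynomial.C (N i j) * MvPolynomial.X j := by simp [lsub]
    have h2 : pderiv j (∑ k, MvPolynomial.C (N i k) * MvPolynomial.X k :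
        MvPolynomial (Fin 3) ℂ) = MvPolynomial.C (N i j) := by
      simp only [map_sum, pderiv_C_mul, pderiv_X]
      rw [Finset.sum_eq_single j]
      · simp
      · intro b _ hb
        simp [Pi.single_apply, hb.symm, hb]
      · simp
    have h3 : MvPolynomial.eval x (∑ k, MvPolynomial.C (N i k) * MvPolynomial.X k :
        MvPolynomial (Fin 3) ℂ) = N.mulVec x i := by
      simp [Matrix.mulVec, dotProduct]
    rw [h1]
    simp only [Derivation.leibniz, map_add, smul_eq_mul, map_mul, h2, h3, hp, eval_lsub,
      MvPolynomial.eval_C, MvPolynomial.eval_X, pderiv_X, mul_add, Finset.sum_add_distrib]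
    congr 1
    · rw [Finset.sum_eq_single i]
      · simp
        ring
      · intro b _ hb
        simp [Pi.single_apply, hb, hb.symm]
      · simp
    · rw [Finset.mul_sum]
      exact Finset.sum_congr rfl fun _ _ => by ring

theorem crit_lsub {N : Matrix (Fin 3) (Fin 3) ℂ} (hN : IsUnit N) (F : MvPolynomial (Fin 3) ℂ)
    (x : Fin 3 → ℂ) (h : ∀ j, MvPolynomial.eval x (pderiv j (lsub N F)) = 0) (i : Fin 3) :
    MvPolynomial.eval (N.mulVec x) (pderiv i F) = 0 := by
  have h1 : Matrix.mulVec N.transpose (fun i => MvPolynomial.eval (N.mulVec x) (pderiv i F)) = 0 := by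
    funext j
    have := h j
    rw [pderiv_lsub] at this
    simpa [Matrix.mulVec, dotProduct] using this
  have hinj := Matrix.mulVec_injective_of_isUnit ((Matrix.isUnit_transpose N).mpr hN)
  have := hinj (h1.trans (Matrix.mulVec_zero _).symm)
  exact congrFun this i

theorem surj_of_isUnit {N : Matrix (Fin 3) (Fin 3) ℂ} (hN : IsUnit N) (y : Fin 3 → ℂ) :
    ∃ x, N.mulVec x = y := by
  refine ⟨N⁻¹.mulVec y, ?_⟩
  rw [Matrix.mulVec_mulVec, Matrix.mul_nonsing_inv _ ((Matrix.isUnit_iff_isUnit_det N).mp hN),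
    Matrix.one_mulVec]

/-- Exponent vectors. -/
def ex (i j k : ℕ) : Fin 3 →₀ ℕ := Finsupp.equivFunOnFinite.symm ![i, j, k]

theorem coeff_tm (a b c i j k : ℕ) (r : ℂ) :
    MvPolynomial.coeff (ex a b c) (tm r i j k) = if i = a ∧ j = b ∧ k = c then r else 0 := by
  have h : tm r i j k = MvPolynomial.monomial (ex i j k) r := by
    rw [MvPolynomial.monomial_eq, Finsupp.prod_fintype _ _ (by simp), Fin.prod_univ_three]
    simp [tm, ex]
    ring
  rw [h, MvPolynomial.coeff_monomial]
  have : ex i j k = ex a b c ↔ i = a ∧ j = b ∧ k = c := by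
    unfold ex
    rw [Equiv.apply_eq_iff_eq]
    constructor
    · intro h
      exact ⟨congrFun h 0, congrFun h 1, congrFun h 2⟩
    · rintro ⟨rfl, rfl, rfl⟩
      rfl
  simp only [this]

theorem quartic_form {G : MvPolynomial (Fin 3) ℂ} (hG : G.IsHomogeneous 4) :
    G = tm (MvPolynomial.coeff (ex 4 0 0) G) 4 0 0 + tm (MvPolynomial.coeff (ex 3 1 0) G) 3 1 0 + tm (MvPolynomial.coeff (ex 2 2 0) G) 2 2 0 + tm (MvPolynomial.coeff (ex 1 3 0) G) 1 3 0 + tm (MvPolynomial.coeff (ex 0 4 0) G) 0 4 0 + tm (MvPolynomial.coeff (ex 3 0 1) G) 3 0 1 + tm (MvPolynomial.coeff (ex 2 1 1) G) 2 1 1 + tm (MvPolynomial.coeff (ex 1 2 1) G) 1 2 1 + tm (MvPolynomial.coeff (ex 0 3 1) G) 0 3 1 + tm (MvPolynomial.coeff (ex 2 0 2) G) 2 0 2 + tm (MvPolynomial.coeff (ex 1 1 2) G) 1 1 2 + tm (MvPolynomial.coeff (ex 0 2 2) G) 0 2 2 + tm (MvPolynomial.coeff (ex 1 0 3) G) 1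 0 3 + tm (MvPolynomial.coeff (ex 0 1 3) G) 0 1 3 + tm (MvPolynomial.coeff (ex 0 0 4) G) 0 0 4 := by
  have hom : (tm (MvPolynomial.coeff (ex 4 0 0) G) 4 0 0 + tm (MvPolynomial.coeff (ex 3 1 0) G) 3 1 0 + tm (MvPolynomial.coeff (ex 2 2 0) G) 2 2 0 + tm (MvPolynomial.coeff (ex 1 3 0) G) 1 3 0 + tm (MvPolynomial.coeff (ex 0 4 0) G) 0 4 0 + tm (MvPolynomial.coeff (ex 3 0 1) G) 3 0 1 + tm (MvPolynomial.coeff (ex 2 1 1) G) 2 1 1 + tm (MvPolynomial.coeff (ex 1 2 1) G) 1 2 1 + tm (MvPolynomial.coeff (ex 0 3 1) G) 0 3 1 + tm (MvPolynomial.coeff (ex 2 0 2) G) 2 0 2 + tm (MvPolynomial.coeff (ex 1 1 2) G) 1 1 2 + tm (MvPolynomial.coeff (ex 0 2 2) G) 0 2 2 + tm (MvPolynomial.coeff (ex 1 0 3) G) 1 0 3 + tm (MvPolynomial.coeff (ex 0 1 3) G) 0 1 3 + tm (MvPolynomial.coeff (ex 0 0 4) G) 0 0 4 : MvPolynomial (Fin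 3) ℂ).IsHomogeneous 4 := by
    repeat' (first | (with_reducible apply tm_hom) | apply MvPolynomial.IsHomogeneous.add)
    all_goals norm_num
  ext d
  by_cases hd : d.degree = 4
  · have hd' : d = ex (d 0) (d 1) (d 2) := by
      ext i
      fin_cases i <;> simp [ex]
    have hs : d 0 + d 1 + d 2 = 4 := by
      rw [← hd, Finsupp.degree_eq_sum, Fin.sum_univ_three]
    rw [hd']
    generalize d 0 = i at hs
    generalize d 1 = j at hs
    generalize d 2 = k at hs
    simp only [MvPolynomial.coeff_add, coeff_tm]
    have hi : i ≤ 4 := by omega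
    have hj : j ≤ 4 := by omega
    obtain rfl : k = 4 - i - j := by omega
    interval_cases i <;> interval_cases j <;> first | omega | simp
  · rw [hG.coeff_eq_zero hd, hom.coeff_eq_zero hd]

/-- The exponents of the twelve monomials. -/
def mexp : Fin 12 → (Fin 3 →₀ ℕ) :=
  ![ex 1 3 0, ex 0 4 0, ex 3 0 1, ex 2 1 1, ex 1 2 1, ex 0 3 1, ex 2 0 2, ex 1 1 2, ex 0 2 2, ex 1 0 3, ex 0 1 3, ex 0 0 4]

/-- The parameters of a quartic. -/
def par (G : MvPolynomial (Fin 3) ℂ) : Fin 12 → ℂ := fun i => MvPolynomial.coeff (mexp i) G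

theorem gQ_par {G : MvPolynomial (Fin 3) ℂ} (hG : G.IsHomogeneous 4)
    (hc : 3 ≤ contactAt G ![1, 0, 0] ![0, 1, 0]) :
    G = gQ (par G) ∧ (par G 0 ≠ 0 ∨ par G 1 ≠ 0) := by
  have hr : lineRestrict G ![1, 0, 0] ![0, 1, 0] =
      Polynomial.C (MvPolynomial.coeff (ex 4 0 0) G) +
      Polynomial.C (MvPolynomial.coeff (ex 3 1 0) G) * Polynomial.X +
      Polynomial.C (MvPolynomial.coeff (ex 2 2 0) G) * Polynomial.X ^ 2 +
      Polynomial.C (MvPolynomial.coeff (ex 1 3 0) G) * Polynomial.X ^ 3 +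
      Polynomial.C (MvPolynomial.coeff (ex 0 4 0) G) * Polynomial.X ^ 4 := by
    conv_lhs => rw [quartic_form hG]
    simp only [lineRestrict, tm, map_add, map_mul, map_pow, MvPolynomial.aeval_X,
      MvPolynomial.algHom_C, Polynomial.algebraMap_eq, Matrix.cons_val]
    simp only [map_one, map_zero]
    ring
  have hne : lineRestrict G ![1, 0, 0] ![0, 1, 0] ≠ 0 := by
    intro h
    simp [contactAt, h] at hc
  have hdvd : Polynomial.X ^ 3 ∣ lineRestrict G ![1, 0, 0] ![0, 1, 0] := by
    have := (Polynomial.le_rootMultiplicity_iff hne).mp hc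
    simpa using this
  rw [Polynomial.X_pow_dvd_iff] at hdvd
  have z0 := hdvd 0 (by norm_num)
  have z1 := hdvd 1 (by norm_num)
  have z2 := hdvd 2 (by norm_num)
  rw [hr] at z0 z1 z2
  simp [Polynomial.coeff_X, Polynomial.coeff_X_pow, Polynomial.coeff_C] at z0 z1 z2
  rw [hr, z0, z1, z2] at hne
  constructor
  · conv_lhs => rw [quartic_form hG, z0, z1, z2]
    simp only [gQ, par, mexp, Matrix.cons_val]
    simp [tm]
  · by_contra hcon
    push Not at hcon
    apply hne
    simp only [par, mexp, Matrix.cons_val] at hcon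
    rw [hcon.1, hcon.2]
    simp

/-- Parameters after the normalizing substitution. -/
def hat {R : Type*} [CommRing R] (c e d : R) (τ : Fin 12 → R) : Fin 12 → R :=
  ![27 * c ^ 3 * τ 0,
    -27 * c ^ 3 * e * τ 0 + 81 * c ^ 4 * τ 1,
    3 * c * τ 2,
    -9 * c * e * τ 2 + 9 * c ^ 2 * τ 3,
    9 * c * e ^ 2 * τ 2 - 18 * c ^ 2 * e * τ 3 + 27 * c ^ 3 * τ 4,
    -3 * c * e ^ 3 * τ 2 + 9 * c ^ 2 * e ^ 2 * τ 3 - 27 * c ^ 3 * d * τ 0 - 27 * c ^ 3 * e * τ 4 + 81 * c ^ 4 * τ 5,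
    -9 * c * d * τ 2 + 9 * c ^ 2 * τ 6,
    18 * c * d * e * τ 2 - 18 * c ^ 2 * d * τ 3 - 18 * c ^ 2 * e * τ 6 + 27 * c ^ 3 * τ 7,
    -9 * c * d * e ^ 2 * τ 2 + 18 * c ^ 2 * d * e * τ 3 + 9 * c ^ 2 * e ^ 2 * τ 6 - 27 * c ^ 3 * d * τ 4 - 27 * c ^ 3 * e * τ 7 + 81 * c ^ 4 * τ 8,
    9 * c * d ^ 2 * τ 2 - 18 * c ^ 2 * d * τ 6 + 27 * c ^ 3 * τ 9,
    -9 * c * d ^ 2 * e * τ 2 + 18 * c ^ 2 * d * e * τ 6 + 9 * c ^ 2 * d ^ 2 * τ 3 - 27 * c ^ 3 * d * τ 7 - 27 * c ^ 3 * e * τ 9 + 81 * c ^ 4 * τ 10,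
    -3 * c * d ^ 3 * τ 2 + 9 * c ^ 2 * d ^ 2 * τ 6 - 27 * c ^ 3 * d * τ 9 + 81 * c ^ 4 * τ 11]

theorem map_hat {R S : Type*} [CommRing R] [CommRing S] (φ : R →+* S) (c e d : R)
    (τ : Fin 12 → R) (i : Fin 12) :
    φ (hat c e d τ i) = hat (φ c) (φ e) (φ d) (fun i => φ (τ i)) i := by
  fin_cases i <;> simp [hat, map_ofNat]

/-- The normalizing substitution. -/
def nmat (c e d : ℂ) : Matrix (Fin 3) (Fin 3) ℂ := !![1, -e, -d; 0, 3 * c, 0; 0, 0, 3 * c]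

theorem nmat_isUnit {c : ℂ} (hc : c ≠ 0) (e d : ℂ) : IsUnit (nmat c e d) := by
  rw [Matrix.isUnit_iff_isUnit_det, isUnit_iff_ne_zero, nmat, Matrix.det_fin_three]
  simp [hc]

theorem lsub_nmat (c e d : ℂ) (τ : Fin 12 → ℂ) :
    lsub (nmat c e d) (gQ τ) = gQ (hat c e d τ) := by
  apply MvPolynomial.funext
  intro x
  rw [eval_lsub]
  simp only [gQ, map_add, eval_tm, hat, Matrix.cons_val]
  simp only [nmat, Matrix.mulVec, dotProduct, Fin.sum_univ_three, Matrix.of_apply, Matrix.cons_val]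
  ring

theorem hat_three (θ : Fin 12 → ℂ) : hat (θ 2) (θ 3) (θ 6) θ 3 = 0 := by
  simp only [hat, Matrix.cons_val]
  ring

theorem hat_six (θ : Fin 12 → ℂ) : hat (θ 2) (θ 3) (θ 6) θ 6 = 0 := by
  simp only [hat, Matrix.cons_val]
  ring

theorem exists_hat {θ : Fin 12 → ℂ} (h3 : θ 3 = 0) (h6 : θ 6 = 0) (h2 : θ 2 ≠ 0) :
    ∃ τ : Fin 12 → ℂ, τ 2 ≠ 0 ∧ hat (τ 2) (τ 3) (τ 6) τ = θ := by
  obtain ⟨m, hm⟩ := IsAlgClosed.exists_pow_nat_eq (3 * θ 2) (n := 2) (by norm_num)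
  have hm0 : m ≠ 0 := by
    rintro rfl
    apply h2
    linear_combination (-1/3) * hm
  have hθ2 : θ 2 = m ^ 2 / 3 := by linear_combination (-1/3) * hm
  refine ⟨![θ 0 / m ^ 3, θ 1 / m ^ 4, θ 2 / m ^ 1, θ 3 / m ^ 2, θ 4 / m ^ 3, θ 5 / m ^ 4, θ 6 / m ^ 2, θ 7 / m ^ 3, θ 8 / m ^ 4, θ 9 / m ^ 3, θ 10 / m ^ 4, θ 11 / m ^ 4], ?_, ?_⟩
  · simp only [Matrix.cons_val]
    exact div_ne_zero h2 (pow_ne_zero _ hm0)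
  · funext i
    fin_cases i <;> simp only [Fin.zero_eta, Fin.mk_one, Fin.reduceFinMk, hat, Matrix.cons_val, h3, h6, hθ2] <;> field_simp <;> ring

theorem exists_frame (p b : Fin 3 → ℂ) (hpb : LinearIndependent ℂ ![p, b]) :
    ∃ N : Matrix (Fin 3) (Fin 3) ℂ, IsUnit N ∧ N.mulVec ![1, 0, 0] = p ∧
      N.mulVec ![0, 1, 0] = b := by
  have hq : ∃ q, q ∉ Submodule.span ℂ (Set.range ![p, b]) := by
    by_contra hcon
    push Not at hcon
    have htop : Submodule.span ℂ (Set.range ![p, b]) = ⊤ := by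
      rw [Submodule.eq_top_iff']
      exact hcon
    have h1 := finrank_span_eq_card hpb
    rw [htop, finrank_top] at h1
    simp at h1
  obtain ⟨q, hq⟩ := hq
  have hli : LinearIndependent ℂ ![p, b, q] := by
    have h1 : LinearIndependent ℂ (Fin.cons q ![p, b] : Fin 3 → (Fin 3 → ℂ)) :=
      linearIndependent_finCons.mpr ⟨hpb, hq⟩
    have h2 := h1.comp ![1, 2, 0] (by decide)
    convert h2 using 1
    funext i
    fin_cases i <;> rfl
  refine ⟨(Matrix.of ![p, b, q]).transpose, ?_, ?_, ?_⟩
  · rw [Matrix.isUnit_transpose, ← Matrix.linearIndependent_rows_iff_isUnit]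
    exact hli
  · funext i
    simp [Matrix.mulVec, dotProduct, Fin.sum_univ_three]
  · funext i
    simp [Matrix.mulVec, dotProduct, Fin.sum_univ_three]

theorem lines_indep {N : Matrix (Fin 3) (Fin 3) ℂ} (hN : IsUnit N) (s t : ℂ) :
    LinearIndependent ℂ ![N.mulVec ![1, 0, s], N.mulVec ![0, 1, t]] := by
  rw [LinearIndependent.pair_iff]
  intro x y h
  have h1 : N.mulVec (x • ![1, 0, s] + y • ![0, 1, t]) = N.mulVec 0 := by
    rw [Matrix.mulVec_add, Matrix.mulVec_smul, Matrix.mulVec_smul, h, Matrix.mulVec_zero]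
  have h2 := Matrix.mulVec_injective_of_isUnit hN h1
  have a := congrFun h2 0
  have c := congrFun h2 1
  simp at a c
  exact ⟨a, c⟩

/-- The parameters as linear forms in the coefficients. -/
def parPoly (N : Matrix (Fin 3) (Fin 3) ℂ) (i : Fin 12) : MvPolynomial (Fin 3 →₀ ℕ) ℂ :=
  ∑ d ∈ (Finset.univ : Finset (Fin 3)).finsuppAntidiag 4,
    MvPolynomial.C (MvPolynomial.coeff (mexp i) (lsub N (MvPolynomial.monomial d 1))) *
      MvPolynomial.X d

theorem eval_parPoly (N : Matrix (Fin 3) (Fin 3) ℂ) (i : Fin 12) {F : MvPolynomial (Fin 3) ℂ}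
    (hF : F.IsHomogeneous 4) :
    MvPolynomial.eval (fun d => F.coeff d) (parPoly N i) = par (lsub N F) i := by
  have h1 : F = ∑ d ∈ (Finset.univ : Finset (Fin 3)).finsuppAntidiag 4,
      MvPolynomial.coeff d F • MvPolynomial.monomial d (1 : ℂ) := by
    conv_lhs => rw [F.as_sum]
    simp only [MvPolynomial.smul_monomial, smul_eq_mul, mul_one]
    apply Finset.sum_subset
    · intro d hd
      rw [Finset.mem_finsuppAntidiag]
      refine ⟨?_, Finset.subset_univ _⟩
      by_contra hne
      rw [MvPolynomial.mem_support_iff] at hd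
      apply hd
      apply hF.coeff_eq_zero
      rwa [Finsupp.degree_eq_sum]
    · intro d _ hd
      rw [MvPolynomial.notMem_support_iff] at hd
      rw [hd, map_zero]
  have h2 : lsub N F = ∑ d ∈ (Finset.univ : Finset (Fin 3)).finsuppAntidiag 4,
      MvPolynomial.coeff d F • lsub N (MvPolynomial.monomial d (1 : ℂ)) := by
    conv_lhs => rw [h1]
    unfold lsub
    rw [map_sum]
    simp only [map_smul]
  unfold par
  rw [h2, MvPolynomial.coeff_sum]
  simp only [parPoly, map_sum, map_mul, MvPolynomial.eval_C, MvPolynomial.eval_X,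
    MvPolynomial.coeff_smul, smul_eq_mul]
  exact Finset.sum_congr rfl fun _ _ => mul_comm _ _

/-- The polynomial cutting out the bad locus. -/
def bad (N : Matrix (Fin 3) (Fin 3) ℂ) (Ψ : MvPolynomial (Fin 12) ℂ) :
    MvPolynomial (Fin 3 →₀ ℕ) ℂ :=
  MvPolynomial.aeval (hat (parPoly N 2) (parPoly N 3) (parPoly N 6) (parPoly N)) Ψ

theorem coeffEval_bad (N : Matrix (Fin 3) (Fin 3) ℂ) (Ψ : MvPolynomial (Fin 12) ℂ)
    {F : MvPolynomial (Fin 3) ℂ} (hF : F.IsHomogeneous 4) :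
    coeffEval (bad N Ψ) F = MvPolynomial.eval (hat (par (lsub N F) 2) (par (lsub N F) 3)
      (par (lsub N F) 6) (par (lsub N F))) Ψ := by
  unfold coeffEval bad
  rw [← MvPolynomial.coe_aeval_eq_eval, ← MvPolynomial.coe_aeval_eq_eval]
  simp only [RingHom.coe_coe]
  rw [← AlgHom.comp_apply, MvPolynomial.comp_aeval]
  congr 2
  funext i
  have := map_hat (MvPolynomial.eval (fun d => F.coeff d)) (parPoly N 2) (parPoly N 3)
    (parPoly N 6) (parPoly N) i
  simp only [eval_parPoly N _ hF] at this
  rw [← this, ← MvPolynomial.coe_aeval_eq_eval]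
  rfl

theorem par_gQ (θ : Fin 12 → ℂ) : par (gQ θ) = θ := by
  funext i
  fin_cases i <;> simp [par, mexp, gQ, coeff_tm]

/-- All that we need to know about a marked quartic. -/
theorem marked {p b : Fin 3 → ℂ} {N : Matrix (Fin 3) (Fin 3) ℂ} (hN : IsUnit N)
    (hp : N.mulVec ![1, 0, 0] = p) (hb : N.mulVec ![0, 1, 0] = b) {F : MvPolynomial (Fin 3) ℂ}
    (hF : InflAtMarkedPoint F p b) :
    lsub N F = gQ (par (lsub N F)) ∧ par (lsub N F) 2 ≠ 0 ∧
      (par (lsub N F) 0 ≠ 0 ∨ par (lsub N F) 1 ≠ 0) := by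
  obtain ⟨⟨hom, _, hs⟩, hc⟩ := hF
  have hc' : 3 ≤ contactAt (lsub N F) ![1, 0, 0] ![0, 1, 0] := by
    unfold contactAt at hc ⊢
    rwa [lineRestrict_lsub, hp, hb]
  obtain ⟨h1, h2⟩ := gQ_par (lsub_hom hom) hc'
  refine ⟨h1, ?_, h2⟩
  intro h0
  have hp0 : p ≠ 0 := by
    rintro rfl
    have := Matrix.mulVec_injective_of_isUnit hN (hp.trans (Matrix.mulVec_zero N).symm)
    have := congrFun this 0
    simp at this
  have he : MvPolynomial.eval p F = 0 := by
    rw [← hp, ← eval_lsub, h1]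
    simp [gQ, eval_tm]
  obtain ⟨i, hi⟩ := hs p hp0 he
  apply hi
  rw [← hp]
  apply crit_lsub hN
  intro j
  rw [h1]
  generalize par (lsub N F) = θ at h0
  fin_cases j
  · simp [gQ, pderiv0_tm, eval_tm]
  · simp [gQ, pderiv1_tm, eval_tm]
  · simp [gQ, pderiv2_tm, eval_tm, h0]

theorem recover_general_quartic_from_inflection_lines_and_point
    (p b : Fin 3 → ℂ) (hpb : LinearIndependent ℂ ![p, b]) :
    ∃ Φ : MvPolynomial (Fin 3 →₀ ℕ) ℂ,
      -- the open locus `{Φ ≠ 0}` meets the family of smooth quartics inflected at `p`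
      -- along `L`, i.e. it determines a nonempty open subset of that family:
      (∃ F : MvPolynomial (Fin 3) ℂ, InflAtMarkedPoint F p b ∧ coeffEval Φ F ≠ 0) ∧
      ∀ F₁ F₂ : MvPolynomial (Fin 3) ℂ,
        InflAtMarkedPoint F₁ p b → InflAtMarkedPoint F₂ p b →
        -- `X₁` is general:
        coeffEval Φ F₁ ≠ 0 →
        -- `X₁` and `X₂` have the same configuration of 24 inflection lines,
        -- counted with multiplicity:
        (∀ a c : Fin 3 → ℂ, LinearIndependent ℂ ![a, c] →
          inflMultLine F₁ a c = inflMultLine F₂ a c) →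
        -- then `X₁ = X₂`:
        ∃ u : ℂ, u ≠ 0 ∧ F₂ = u • F₁ := by
  obtain ⟨N, hN, hp, hb⟩ := exists_frame p b hpb
  obtain ⟨Ψ, ⟨θ, h3, h6, hθ⟩, hΨ⟩ := generic_normalized
  refine ⟨bad N Ψ, ?_, ?_⟩
  · obtain ⟨h0, h2, hC, -, -, -⟩ := hΨ θ hθ
    obtain ⟨τ, hτ2, hτ⟩ := exists_hat h3 h6 h2
    have hNd := (Matrix.isUnit_iff_isUnit_det N).mp hN
    have hFN : lsub N (lsub N⁻¹ (gQ τ)) = gQ τ := by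
      apply MvPolynomial.funext
      intro x
      rw [eval_lsub, eval_lsub, Matrix.mulVec_mulVec, Matrix.nonsing_inv_mul _ hNd,
        Matrix.one_mulVec]
    have hom : (lsub N⁻¹ (gQ τ)).IsHomogeneous 4 := lsub_hom (gQ_hom τ)
    generalize lsub N⁻¹ (gQ τ) = F at hFN hom
    have hM := nmat_isUnit hτ2 (τ 3) (τ 6)
    have hpar : lsub (nmat (τ 2) (τ 3) (τ 6)) (lsub N F) = gQ θ := by
      rw [hFN, lsub_nmat, hτ]
    have hτ0 : τ 0 ≠ 0 := by
      intro h
      apply h0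
      rw [← hτ]
      simp [hat, h]
    have hr : lineRestrict F p b =
        Polynomial.X ^ 3 * (Polynomial.C (τ 0) + Polynomial.C (τ 1) * Polynomial.X) := by
      rw [← hp, ← hb, ← lineRestrict_lsub, hFN]
      simp only [lineRestrict, gQ, tm, map_add, map_mul, map_pow, MvPolynomial.aeval_X,
        MvPolynomial.algHom_C, Polynomial.algebraMap_eq, Matrix.cons_val]
      simp only [map_one, map_zero]
      ring
    have hrne : lineRestrict F p b ≠ 0 := by
      intro h
      rw [hr] at h
      have := congrArg (fun P => Polynomial.coeff P 3) h
      simp only [Polynomial.coeff_X_pow_mul', le_refl, if_true] at this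
      simp at this
      exact hτ0 this
    refine ⟨F, ⟨⟨hom, ?_, ?_⟩, ?_⟩, ?_⟩
    · rintro rfl
      apply hrne
      simp [lineRestrict]
    · intro x hx _
      by_contra hcon
      push Not at hcon
      obtain ⟨y, rfl⟩ := surj_of_isUnit hN x
      obtain ⟨z, rfl⟩ := surj_of_isUnit hM y
      apply hx
      have : z = 0 := by
        apply hC
        intro j
        rw [← hpar, pderiv_lsub]
        apply Finset.sum_eq_zero
        intro i _
        rw [pderiv_lsub, Finset.sum_eq_zero, mul_zero]
        intro k _
        rw [hcon, mul_zero]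
      rw [this, Matrix.mulVec_zero, Matrix.mulVec_zero]
    · unfold contactAt
      rw [Polynomial.le_rootMultiplicity_iff hrne, hr]
      simp
    · rw [coeffEval_bad N Ψ hom, hFN, par_gQ, hτ]
      exact hθ
  · intro F₁ F₂ hF₁ hF₂ hgen hinf
    rw [coeffEval_bad N Ψ hF₁.1.1] at hgen
    obtain ⟨a1, a2, -⟩ := marked hN hp hb hF₁
    obtain ⟨b1, b2, b3⟩ := marked hN hp hb hF₂
    generalize par (lsub N F₁) = θ₁ at *
    generalize par (lsub N F₂) = θ₂ at *
    obtain ⟨c0, c2, -, hE, hI, hR⟩ := hΨ _ hgen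
    have hM := nmat_isUnit a2 (θ₁ 3) (θ₁ 6)
    have hNM : IsUnit (N * nmat (θ₁ 2) (θ₁ 3) (θ₁ 6)) := hN.mul hM
    obtain ⟨u, hu, hcore⟩ := core (τ := hat (θ₁ 2) (θ₁ 3) (θ₁ 6) θ₂) (hat_three θ₁) (hat_six θ₁)
      c0 c2
      (by
        simp only [hat, Matrix.cons_val]
        intro h
        apply b2
        have : θ₁ 2 * θ₂ 2 = 0 := by linear_combination (1/3) * h
        exact (mul_eq_zero.mp this).resolve_left a2)
      (by
        by_contra hcon
        push Not at hcon
        simp only [hat, Matrix.cons_val] at hcon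
        obtain ⟨e0, e1⟩ := hcon
        have f0 : θ₂ 0 = 0 := by
          have : θ₁ 2 ^ 3 * θ₂ 0 = 0 := by linear_combination (1/27) * e0
          exact (mul_eq_zero.mp this).resolve_left (pow_ne_zero _ a2)
        rw [f0] at e1
        have f1 : θ₂ 1 = 0 := by
          have : θ₁ 2 ^ 4 * θ₂ 1 = 0 := by linear_combination (1/81) * e1
          exact (mul_eq_zero.mp this).resolve_left (pow_ne_zero _ a2)
        rcases b3 with h | h
        · exact h f0
        · exact h f1)
      hR hE hI
      (by
        intro s t
        rw [← lsub_nmat, ← lsub_nmat, ← a1, ← b1]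
        simp only [inflMultLine_lsub]
        apply hinf
        have := lines_indep hNM s t
        simpa only [Matrix.mulVec_mulVec] using this)
    refine ⟨u, hu, ?_⟩
    apply MvPolynomial.funext
    intro x
    obtain ⟨y, rfl⟩ := surj_of_isUnit hN x
    obtain ⟨z, rfl⟩ := surj_of_isUnit hM y
    rw [MvPolynomial.smul_eval]
    rw [← eval_lsub, ← eval_lsub, ← eval_lsub, ← eval_lsub, a1, b1, lsub_nmat, lsub_nmat]
    simp only [gQ, map_add, eval_tm, hcore]
    ring

end Infl
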